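/- There exists an element δ of H̃_4(M_13; ℤ) whose image under the homomorphism H̃_4(M_13; ℤ) → H̃_4(M_14; ℤ) induced by the inclusion M_13 ⊆ M_14 has order a nonzero multiple of 5; consequently the order of δ in H̃_4(M_13; ℤ) is either infinite or a nonzero multiple of 5. -/

import Mathlib

set_option synthInstance.maxHeartbeats 1000000
set_option maxHeartbeats 1000000

noncomputable section

namespace MatchPaper

attribute [local instance 10] Classical.propDecidable

/-! ### Guarded constructions on additive groups -/

section AddGadgets

variable {A B : Type*} [AddCommGroup A] [AddCommGroup B]

/-- Lift a homomorphism to the quotient (it genuinely descends whenever it kills `S`). -/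
def liftOrZero (S : AddSubgroup A) (f : A →+ B) : A ⧸ S →+ B :=
  if h : S ≤ f.ker then QuotientAddGroup.lift S f h else 0

/-- Descend a homomorphism to quotients (genuine whenever `f S ≤ T`). -/
def descend (S : AddSubgroup A) (T : AddSubgroup B) (f : A →+ B) : A ⧸ S →+ B ⧸ T :=
  if h : S ≤ T.comap f then QuotientAddGroup.map S T f h else 0

/-- Restrict a homomorphism to subgroups (genuine whenever `f Z ≤ Z'`). -/
def restrictHom (f : A →+ B) (Z : AddSubgroup A) (Z' : AddSubgroup B) : Z →+ Z' :=
  if h : ∀ x : Z, f x ∈ Z' then (f.comp Z.subtype).codRestrict Z' (fun x => h x) else 0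

/-- The subquotient `Z / (Bd ∩ Z)`. -/
abbrev subQuot (Z Bd : AddSubgroup A) : Type _ := Z ⧸ Bd.addSubgroupOf Z

/-- The map induced by `f` on subquotients. -/
def subQuotMap (f : A →+ B) (Z Bd : AddSubgroup A) (Z' Bd' : AddSubgroup B) :
    subQuot Z Bd →+ subQuot Z' Bd' :=
  descend (Bd.addSubgroupOf Z) (Bd'.addSubgroupOf Z') (restrictHom f Z Z')

end AddGadgets

/-! ### Chain complexes of abelian groups, group actions, quotient and fixed-difference
subcomplexes, and homology -/

section Abstract

variable (X : ℤ → Type*) [∀ i, AddCommGroup (X i)]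

/-- Transport along an equality of indices. -/
def castAE {i j : ℤ} (h : i = j) : X i ≃+ X j := by subst h; exact AddEquiv.refl _

variable (d : ∀ i : ℤ, X (i + 1) →+ X i)

/-- The boundary map leaving degree `i`. -/
def dfrom (i : ℤ) : X i →+ X (i - 1) :=
  (d (i - 1)).comp (castAE X (show i = (i - 1) + 1 by ring)).toAddMonoidHom

/-- Cycles in degree `i`. -/
def cyc (i : ℤ) : AddSubgroup (X i) := (dfrom X d i).ker

/-- Boundaries in degree `i`. -/
def bdr (i : ℤ) : AddSubgroup (X i) := (d i).range

/-- Homology of the chain complex `(X, d)` in degree `i`. -/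
abbrev Hgrp (i : ℤ) : Type _ := subQuot (cyc X d i) (bdr X d i)

variable {G : Type*} [Group G] (act : G → ∀ i : ℤ, X i ≃+ X i)

/-- The subgroup `C_i^G` generated by the elements `c - g c`. -/
def gsub (i : ℤ) : AddSubgroup (X i) :=
  AddSubgroup.closure {x | ∃ (c : X i) (g : G), x = c - act g i c}

/-- The degree-`i` part of the quotient complex `C/G`. -/
abbrev QX (i : ℤ) : Type _ := X i ⧸ gsub X act i

/-- The boundary map of the quotient complex `C/G`. -/
def qd (i : ℤ) : QX X act (i + 1) →+ QX X act i :=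
  descend (gsub X act (i + 1)) (gsub X act i) (d i)

/-- Homology of the quotient complex `C/G`. -/
abbrev HQgrp (i : ℤ) : Type _ := Hgrp (QX X act) (qd X d act) i

/-- The boundary map of the subcomplex `C^G`. -/
def sd (i : ℤ) : gsub X act (i + 1) →+ gsub X act i :=
  restrictHom (d i) (gsub X act (i + 1)) (gsub X act i)

/-- Homology of the subcomplex `C^G`. -/
abbrev HSgrp (i : ℤ) : Type _ := Hgrp (fun j => gsub X act j) (sd X d act) i

/-- The projection chain map `C → C/G`. -/
def projX (i : ℤ) : X i →+ QX X act i := QuotientAddGroup.mk' _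

/-- The map `π*` induced on homology by the projection `C → C/G`. -/
def piStar (i : ℤ) : Hgrp X d i →+ HQgrp X d act i :=
  subQuotMap (projX X act i) (cyc X d i) (bdr X d i)
    (cyc (QX X act) (qd X d act) i) (bdr (QX X act) (qd X d act) i)

/-- The chain map `φ : C/G → C`, `[c] ↦ ∑ g • c`. -/
def phiX [Fintype G] (i : ℤ) : QX X act i →+ X i :=
  liftOrZero (gsub X act i) (∑ g : G, (act g i).toAddMonoidHom)

/-- The map `φ*` induced on homology by `φ`. -/
def phiStar [Fintype G] (i : ℤ) : HQgrp X d act i →+ Hgrp X d i :=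
  subQuotMap (phiX X act i) (cyc (QX X act) (qd X d act) i) (bdr (QX X act) (qd X d act) i)
    (cyc X d i) (bdr X d i)

end Abstract

/-! ### Guarded constructions on modules -/

section LinGadgets

variable (R : Type*) [CommRing R] {M N : Type*} [AddCommGroup M] [Module R M]
  [AddCommGroup N] [Module R N]

def liftOrZeroL (S : Submodule R M) (f : M →ₗ[R] N) : (M ⧸ S) →ₗ[R] N :=
  if h : S ≤ LinearMap.ker f then S.liftQ f h else 0

def descendL (S : Submodule R M) (T : Submodule R N) (f : M →ₗ[R] N) :
    (M ⧸ S) →ₗ[R] (N ⧸ T) :=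
  if h : S ≤ T.comap f then S.mapQ T f h else 0

def restrictL (f : M →ₗ[R] N) (Z : Submodule R M) (Z' : Submodule R N) : Z →ₗ[R] Z' :=
  if h : ∀ x ∈ Z, f x ∈ Z' then f.restrict h else 0

/-- The subquotient `Z / (Bd ∩ Z)`. -/
abbrev subQuotL (Z Bd : Submodule R M) : Type _ := Z ⧸ Bd.comap Z.subtype

def subQuotMapL (f : M →ₗ[R] N) (Z Bd : Submodule R M) (Z' Bd' : Submodule R N) :
    subQuotL R Z Bd →ₗ[R] subQuotL R Z' Bd' :=
  descendL R (Bd.comap Z.subtype) (Bd'.comap Z'.subtype) (restrictL R f Z Z')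

end LinGadgets

/-! ### Reduced simplicial chains and homology of a family of finite sets

A family `K : Finset V → Prop` of finite subsets of a vertex type `V` (in our applications a
simplicial complex, in particular closed under taking subsets and containing `∅`) has reduced
simplicial chain groups over a ring `R`: the degree-`d` chain group is free on the faces of
cardinality `d + 1`, i.e. we index chain groups by the cardinality `c = d + 1` of the faces,
with the empty face (cardinality `0`, degree `-1`) giving the augmentation.  Orientations are
induced by an injection `rank : V → ℕ` of the vertices into `ℕ`. -/

section Simplicial

variable (R : Type*) [CommRing R]

/-- Chains on the faces of cardinality `c` of the family `K`. -/
abbrev SChain {V : Type*} (K : Finset V → Prop) (c : ℕ) : Type _ :=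
  {σ : Finset V // K σ ∧ σ.card = c} →₀ R

/-- The basis chain of a face, or zero for a non-face. -/
def basisOrZero {V : Type*} (K : Finset V → Prop) (c : ℕ) (τ : Finset V) : SChain R K c :=
  if h : K τ ∧ τ.card = c then Finsupp.single ⟨τ, h⟩ (1 : R) else 0

/-- The simplicial boundary map, with signs determined by the ordering of the vertices via
`rank`. -/
def bdry {V : Type*} [DecidableEq V] (rank : V → ℕ) (K : Finset V → Prop) (c : ℕ) :
    SChain R K (c + 1) →ₗ[R] SChain R K c :=
  Finsupp.lsum R fun σ => LinearMap.toSpanSingleton R _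
    (∑ v ∈ σ.1, ((-1 : ℤ) ^ ((σ.1.filter fun u => rank u < rank v).card) •
      basisOrZero R K c (σ.1.erase v)))

/-- The orientation sign of a map `f` on a face `σ`: the parity of the number of inversions. -/
def mapSign {V W : Type*} (rank : V → ℕ) (rank' : W → ℕ) (f : V → W) (σ : Finset V) : ℤ :=
  (-1) ^ (((σ ×ˢ σ).filter fun p => rank p.1 < rank p.2 ∧ rank' (f p.2) < rank' (f p.1)).card)

/-- The chain map induced by a map `f` on vertices, taking orientations into account. -/
def chainMap {V W : Type*} [DecidableEq V] [DecidableEq W] (rank : V → ℕ) (rank' : W → ℕ)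
    (f : V → W) (K : Finset V → Prop) (K' : Finset W → Prop) (c : ℕ) :
    SChain R K c →ₗ[R] SChain R K' c :=
  Finsupp.lsum R fun σ => LinearMap.toSpanSingleton R _
    (mapSign rank rank' f σ.1 • basisOrZero R K' c (σ.1.image f))

/-- Cycles among the chains on faces of cardinality `c` (for `c = 0` everything is a cycle:
the boundary map leaving degree `-1` is zero). -/
def cycLow {V : Type*} [DecidableEq V] (rank : V → ℕ) (K : Finset V → Prop) :
    (c : ℕ) → Submodule R (SChain R K c)
  | 0 => ⊤
  | (m + 1) => LinearMap.ker (bdry R rank K m)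

/-- Reduced simplicial homology at the faces of cardinality `c`, i.e. in degree `c - 1`. -/
abbrev RHc {V : Type*} [DecidableEq V] (rank : V → ℕ) (K : Finset V → Prop) (c : ℕ) : Type _ :=
  subQuotL R (cycLow R rank K c) (LinearMap.range (bdry R rank K c))

/-- Reduced simplicial homology `H̃_dg(K; R)`. -/
abbrev RH {V : Type*} [DecidableEq V] (rank : V → ℕ) (K : Finset V → Prop) (dg : ℕ) : Type _ :=
  RHc R rank K (dg + 1)

end Simplicial

/-! ### The matching complex and the complexes of graphs of bounded degree -/

/-- The standard injection of pairs into `ℕ`, inducing the lexicographic order. -/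
def rankP (m : ℕ) : Fin m × Fin m → ℕ := fun p => p.1.val * m + p.2.val

/-- A face of the matching complex `M_m`: a set of edges `(i, j)`, `i < j`, of the complete
graph on `Fin m`, no two of which share an endpoint. -/
def IsMatching (m : ℕ) (σ : Finset (Fin m × Fin m)) : Prop :=
  (∀ p ∈ σ, p.1 < p.2) ∧
    ∀ p ∈ σ, ∀ q ∈ σ, p ≠ q → p.1 ≠ q.1 ∧ p.1 ≠ q.2 ∧ p.2 ≠ q.1 ∧ p.2 ≠ q.2

/-- `H̃_dg(M_m; R)`, the reduced homology of the matching complex on `m` vertices. -/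
abbrev MH (R : Type*) [CommRing R] (m dg : ℕ) : Type _ := RH R (rankP m) (IsMatching m) dg

/-- The degree of the vertex `i` in the graph `σ` (a loop `(i, i)` counts twice). -/
def degB {n : ℕ} (σ : Finset (Fin n × Fin n)) (i : Fin n) : ℕ :=
  ∑ p ∈ σ, ((if p.1 = i then 1 else 0) + (if p.2 = i then 1 else 0))

/-- A face of `BD_n^λ`: a graph on `Fin n` (loops allowed, encoded as pairs `(i, j)` with
`i ≤ j`) in which the vertex `i` has degree at most `λ i`. -/
def IsBDGraph {n : ℕ} (lam : Fin n → ℕ) (σ : Finset (Fin n × Fin n)) : Prop :=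
  (∀ p ∈ σ, p.1 ≤ p.2) ∧ ∀ i, degB σ i ≤ lam i

/-- `H̃_dg(BD_n^λ; R)`. -/
abbrev BDH (R : Type*) [CommRing R] {n : ℕ} (lam : Fin n → ℕ) (dg : ℕ) : Type _ :=
  RH R (rankP n) (IsBDGraph lam) dg

/-! ### The Young group action on the matching complex -/

/-- The action of a permutation of the vertices on the edges of the complete graph. -/
def emap {m : ℕ} (g : Equiv.Perm (Fin m)) : Fin m × Fin m → Fin m × Fin m :=
  fun p => (min (g p.1) (g p.2), max (g p.1) (g p.2))

/-- The quotient map on edges induced by a surjection `kap` on vertices (whose fibers are the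
blocks `U_i` of the partition). -/
def kmap {N n : ℕ} (kap : Fin N → Fin n) : Fin N × Fin N → Fin n × Fin n :=
  fun p => (min (kap p.1) (kap p.2), max (kap p.1) (kap p.2))

/-- Membership of a permutation in the Young group: it preserves each block of the partition
determined by `kap`. -/
def KeepsBlocks {N n : ℕ} (kap : Fin N → Fin n) (g : Equiv.Perm (Fin N)) : Prop :=
  ∀ x, kap (g x) = kap x

section YoungAction

variable (R : Type*) [CommRing R]

/-- The action of a permutation `g` of the `N` vertices on chains. -/
def actC (N : ℕ) (K : Finset (Fin N × Fin N) → Prop) (g : Equiv.Perm (Fin N)) (c : ℕ) :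
    SChain R K c →ₗ[R] SChain R K c :=
  chainMap R (rankP N) (rankP N) (emap g) K K c

/-- The submodule of chains generated by the elements `c - g c`, `g` in the Young group. -/
def ysub (N n : ℕ) (kap : Fin N → Fin n) (K : Finset (Fin N × Fin N) → Prop) (c : ℕ) :
    Submodule R (SChain R K c) :=
  Submodule.span R {x | ∃ (ch : SChain R K c) (g : Equiv.Perm (Fin N)),
    KeepsBlocks kap g ∧ x = ch - actC R N K g c ch}

/-- The chains of the quotient complex `C̃/S_λ`. -/
abbrev QC (N n : ℕ) (kap : Fin N → Fin n) (K : Finset (Fin N × Fin N) → Prop) (c : ℕ) :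
    Type _ :=
  SChain R K c ⧸ ysub R N n kap K c

/-- The boundary map of the quotient complex `C̃/S_λ`. -/
def qbdry (N n : ℕ) (kap : Fin N → Fin n) (K : Finset (Fin N × Fin N) → Prop) (c : ℕ) :
    QC R N n kap K (c + 1) →ₗ[R] QC R N n kap K c :=
  descendL R (ysub R N n kap K (c + 1)) (ysub R N n kap K c) (bdry R (rankP N) K c)

/-- Homology of the quotient complex `C̃(M_N)/S_λ` in degree `dg`. -/
abbrev QMH (N n : ℕ) (kap : Fin N → Fin n) (dg : ℕ) : Type _ :=
  subQuotL R (LinearMap.ker (qbdry R N n kap (IsMatching N) dg))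
    (LinearMap.range (qbdry R N n kap (IsMatching N) (dg + 1)))

/-- The chain map `φ : C̃/S_λ → C̃`, `[c] ↦ ∑_{g ∈ S_λ} g c`. -/
def phiC (N n : ℕ) (kap : Fin N → Fin n) (K : Finset (Fin N × Fin N) → Prop) (c : ℕ) :
    QC R N n kap K c →ₗ[R] SChain R K c :=
  liftOrZeroL R (ysub R N n kap K c)
    (∑ g ∈ Finset.univ.filter (fun g : Equiv.Perm (Fin N) => ∀ x, kap (g x) = kap x),
      actC R N K g c)

/-- The map `φ* : H_dg(C̃(M_N)/S_λ) → H̃_dg(M_N; R)` induced by `φ`. -/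
def phiStarM (N n : ℕ) (kap : Fin N → Fin n) (dg : ℕ) :
    QMH R N n kap dg →ₗ[R] MH R N dg :=
  subQuotMapL R (phiC R N n kap (IsMatching N) (dg + 1))
    (LinearMap.ker (qbdry R N n kap (IsMatching N) dg))
    (LinearMap.range (qbdry R N n kap (IsMatching N) (dg + 1)))
    (cycLow R (rankP N) (IsMatching N) (dg + 1))
    (LinearMap.range (bdry R (rankP N) (IsMatching N) (dg + 1)))

end YoungAction

/-! ### The subfamilies `Δ_λ` and `Γ_λ` of the matching complex -/

/-- `σ` contains two distinct edges `ab`, `cd` with `a, c` in the same block and `b, d` in the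
same block. -/
def InDelta {N n : ℕ} (kap : Fin N → Fin n) (σ : Finset (Fin N × Fin N)) : Prop :=
  ∃ p ∈ σ, ∃ q ∈ σ, p ≠ q ∧
    ((kap p.1 = kap q.1 ∧ kap p.2 = kap q.2) ∨ (kap p.1 = kap q.2 ∧ kap p.2 = kap q.1))

/-- A face of `Δ_λ`. -/
def IsDelta {N n : ℕ} (kap : Fin N → Fin n) (σ : Finset (Fin N × Fin N)) : Prop :=
  IsMatching N σ ∧ InDelta kap σ

/-- A face of `Γ_λ = M_N \ Δ_λ`. -/
def IsGamma {N n : ℕ} (kap : Fin N → Fin n) (σ : Finset (Fin N × Fin N)) : Prop :=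
  IsMatching N σ ∧ ¬ InDelta kap σ

section YoungMore

variable (R : Type*) [CommRing R]

/-- The map `κ̂ : C̃(Γ_λ)/S_λ → C̃(BD_n^λ)`, `[c] ↦ κ(c)`. -/
def khat (N n : ℕ) (kap : Fin N → Fin n) (lam : Fin n → ℕ) (c : ℕ) :
    QC R N n kap (IsGamma kap) c →ₗ[R] SChain R (IsBDGraph lam) c :=
  liftOrZeroL R (ysub R N n kap (IsGamma kap) c)
    (chainMap R (rankP N) (rankP n) (kmap kap) (IsGamma kap) (IsBDGraph lam) c)

/-- The boundary map of the subcomplex `C̃(M_N; R)^{S_λ}`. -/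
def sbdry (N n : ℕ) (kap : Fin N → Fin n) (c : ℕ) :
    ysub R N n kap (IsMatching N) (c + 1) →ₗ[R] ysub R N n kap (IsMatching N) c :=
  restrictL R (bdry R (rankP N) (IsMatching N) c)
    (ysub R N n kap (IsMatching N) (c + 1)) (ysub R N n kap (IsMatching N) c)

/-- Homology of the subcomplex `C̃(M_N; R)^{S_λ}` in degree `dg`: the cycles of the
subcomplex (elements of the subcomplex with vanishing boundary) modulo the boundaries of
elements of the subcomplex. -/
abbrev SubH (N n : ℕ) (kap : Fin N → Fin n) (dg : ℕ) : Type _ :=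
  subQuotL R
    (ysub R N n kap (IsMatching N) (dg + 1) ⊓ cycLow R (rankP N) (IsMatching N) (dg + 1))
    ((ysub R N n kap (IsMatching N) (dg + 1 + 1)).map (bdry R (rankP N) (IsMatching N) (dg + 1)))

/-! ### Inclusion maps between matching complexes -/

/-- The chain map induced by the inclusion `M_m ⊆ M_{m'}`. -/
def inclChain (m m' : ℕ) (h : m ≤ m') (c : ℕ) :
    SChain R (IsMatching m) c →ₗ[R] SChain R (IsMatching m') c :=
  chainMap R (rankP m) (rankP m') (fun p => (Fin.castLE h p.1, Fin.castLE h p.2))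
    (IsMatching m) (IsMatching m') c

/-- The map `H̃_dg(M_m; R) → H̃_dg(M_{m'}; R)` induced by the inclusion. -/
def inclStar (m m' : ℕ) (h : m ≤ m') (dg : ℕ) : MH R m dg →ₗ[R] MH R m' dg :=
  subQuotMapL R (inclChain R m m' h (dg + 1))
    (cycLow R (rankP m) (IsMatching m) (dg + 1))
    (LinearMap.range (bdry R (rankP m) (IsMatching m) (dg + 1)))
    (cycLow R (rankP m') (IsMatching m') (dg + 1))
    (LinearMap.range (bdry R (rankP m') (IsMatching m') (dg + 1)))

/-! ### The pair `(M_m, M_m \ e)`, where `e` is the last edge -/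

/-- The edge `e` between the last two of the `m` vertices. -/
def eEdge (m : ℕ) (h : 2 ≤ m) : Fin m × Fin m := (⟨m - 2, by omega⟩, ⟨m - 1, by omega⟩)

/-- A face of `M_m \ e`: a matching not containing the edge `e`. -/
def MnMinusE (m : ℕ) (h : 2 ≤ m) (σ : Finset (Fin m × Fin m)) : Prop :=
  IsMatching m σ ∧ eEdge m h ∉ σ

/-- Pass from a set of edges avoiding the last two vertices of `Fin m` to a set of edges on
`Fin (m - 2)`. -/
def shrink (m : ℕ) (σ : Finset (Fin m × Fin m)) : Finset (Fin (m - 2) × Fin (m - 2)) :=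
  (σ.filter fun p => p.1.val < m - 2 ∧ p.2.val < m - 2).attach.image
    fun p => (⟨p.1.1.val, (Finset.mem_filter.mp p.2).2.1⟩,
              ⟨p.1.2.val, (Finset.mem_filter.mp p.2).2.2⟩)

/-- The chain map realizing the composition
`C̃(M_m) → C̃(M_m, M_m \ e) ≅ C̃(M_{m - 2})[1]`: a face `σ` containing `e` is written as
`σ = ± e ∧ w` and sent to `± w`, viewed in the matching complex on the remaining `m - 2`
vertices; a face not containing `e` is sent to zero. -/
def theta (m : ℕ) (hm : 2 ≤ m) (c : ℕ) :
    SChain R (IsMatching m) (c + 1) →ₗ[R] SChain R (IsMatching (m - 2)) c :=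
  Finsupp.lsum R fun σ => LinearMap.toSpanSingleton R _
    (if eEdge m hm ∈ σ.1 then
      ((-1 : ℤ) ^ c) • basisOrZero R (IsMatching (m - 2)) c (shrink m (σ.1.erase (eEdge m hm)))
     else 0)

/-- The map `H̃_dg(M_m \ e; R) → H̃_dg(M_m; R)` induced by the inclusion. -/
def inclEStar (m : ℕ) (hm : 2 ≤ m) (dg : ℕ) :
    RH R (rankP m) (MnMinusE m hm) dg →ₗ[R] MH R m dg :=
  subQuotMapL R (chainMap R (rankP m) (rankP m) id (MnMinusE m hm) (IsMatching m) (dg + 1))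
    (cycLow R (rankP m) (MnMinusE m hm) (dg + 1))
    (LinearMap.range (bdry R (rankP m) (MnMinusE m hm) (dg + 1)))
    (cycLow R (rankP m) (IsMatching m) (dg + 1))
    (LinearMap.range (bdry R (rankP m) (IsMatching m) (dg + 1)))

/-- The composition `H̃_dg(M_m; R) → H_dg(M_m, M_m \ e; R) ≅ H̃_{dg - 1}(M_{m - 2}; R)` of the
map to relative homology with the canonical isomorphism. -/
def thetaStar (m : ℕ) (hm : 2 ≤ m) (dg : ℕ) :
    MH R m dg →ₗ[R] RHc R (rankP (m - 2)) (IsMatching (m - 2)) dg :=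
  subQuotMapL R (theta R m hm dg)
    (cycLow R (rankP m) (IsMatching m) (dg + 1))
    (LinearMap.range (bdry R (rankP m) (IsMatching m) (dg + 1)))
    (cycLow R (rankP (m - 2)) (IsMatching (m - 2)) dg)
    (LinearMap.range (bdry R (rankP (m - 2)) (IsMatching (m - 2)) dg))

end YoungMore

end MatchPaper

end

namespace FiveTor

/-! ### Alternating functions on words -/

section Words

variable {E M : Type*} [AddCommGroup M]

/-- A function on words which changes sign when two adjacent letters are exchanged. -/
def Alt (g : List E → M) : Prop :=
  ∀ p a b q, g (p ++ a :: b :: q) = - g (p ++ b :: a :: q)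

/-- The alternating sum over all ways to pick a letter. -/
def psum (h : E → List E → M) : List E → M
  | [] => 0
  | a :: l => h a l - psum (fun x r => h x (a :: r)) l

theorem Alt.cons {g : List E → M} (hg : Alt g) (x : E) : Alt (fun r => g (x :: r)) := by
  intro p a b q
  exact hg (x :: p) a b q

theorem psum_neg (h : E → List E → M) (l : List E) :
    psum (fun x r => - h x r) l = - psum h l := by
  induction l generalizing h with
  | nil => simp [psum]
  | cons a l ih =>
    simp only [psum]
    rw [ih (fun x r => h x (a :: r))]
    abel

theorem psum_alt (h : E → List E → M) (hh : ∀ x, Alt (h x)) : Alt (psum h) := by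
  intro p
  induction p generalizing h with
  | nil =>
    intro a b q
    simp only [List.nil_append, psum]
    have e : (fun x r => h x (b :: a :: r)) = fun x r => - h x (a :: b :: r) := by
      funext x r
      exact hh x [] b a r
    rw [e, psum_neg (fun x r => h x (a :: b :: r))]
    abel
  | cons y p ih =>
    intro a b q
    simp only [List.cons_append, psum]
    rw [hh y p a b q, ih (fun x r => h x (y :: r)) (fun x => (hh x).cons y) a b q]
    abel

theorem Alt.zero_of_perm_aux {k : List E → M} (hk : Alt k) {l l' : List E} (hl : l.Perm l') :
    ∀ p, k (p ++ l) = 0 ↔ k (p ++ l') = 0 := by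
  induction hl with
  | nil => simp
  | cons x _ ih =>
    intro p
    have := ih (p ++ [x])
    simpa using this
  | swap x y l =>
    intro p
    rw [hk p y x l, neg_eq_zero]
  | trans _ _ ih1 ih2 => exact fun p => (ih1 p).trans (ih2 p)

theorem Alt.zero_of_perm {k : List E → M} (hk : Alt k) {l l' : List E} (hl : l.Perm l')
    (h : k l' = 0) : k l = 0 := by
  have := (hk.zero_of_perm_aux hl []).2 (by simpa using h)
  simpa using this

theorem Alt.zero_of_not_nodup {k : List E → M} (hk : Alt k) (h2 : ∀ m : M, m = - m → m = 0)
    {l : List E} (hl : ¬ l.Nodup) : k l = 0 := by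
  classical
  obtain ⟨a, ha⟩ := List.exists_duplicate_iff_not_nodup.2 hl
  rw [List.duplicate_iff_two_le_count] at ha
  have h1 : a ∈ l := List.count_pos_iff.1 (by omega)
  have h3 : a ∈ l.erase a := by
    apply List.count_pos_iff.1
    rw [List.count_erase_self]
    omega
  have hp : l.Perm (a :: a :: (l.erase a).erase a) :=
    (List.perm_cons_erase h1).trans ((List.perm_cons_erase h3).cons a)
  apply hk.zero_of_perm hp
  apply h2
  exact hk [] a a _

theorem psum_congr {h h' : E → List E → M} {l : List E}
    (H : ∀ x r, (x :: r).Perm l → h x r = h' x r) : psum h l = psum h' l := by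
  induction l generalizing h h' with
  | nil => rfl
  | cons a l ih =>
    simp only [psum]
    rw [H a l (List.Perm.refl _), ih (h := fun x r => h x (a :: r)) (h' := fun x r => h' x (a :: r))]
    intro x r hx
    apply H
    exact (List.Perm.swap a x r).trans (hx.cons a)

theorem psum_map {F : Type*} (e : F → E) (h : E → List E → M) (l : List F) :
    psum h (l.map e) = psum (fun x r => h (e x) (r.map e)) l := by
  induction l generalizing h with
  | nil => rfl
  | cons a l ih => simp only [List.map_cons, psum, ih]

theorem psum_hom {N : Type*} [AddCommGroup N] (φ : M →+ N) (h : E → List E → M) (l : List E) :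
    φ (psum h l) = psum (fun x r => φ (h x r)) l := by
  induction l generalizing h with
  | nil => simp [psum]
  | cons a l ih => simp only [psum, map_sub, ih]

theorem psum_sum {ι : Type*} (s : Finset ι) (h : ι → E → List E → M) (l : List E) :
    psum (fun x r => ∑ i ∈ s, h i x r) l = ∑ i ∈ s, psum (h i) l := by
  induction l generalizing h with
  | nil => simp [psum]
  | cons a l ih =>
    simp only [psum, Finset.sum_sub_distrib]
    rw [ih (fun i x r => h i x (a :: r))]

theorem exists_of_psum_ne_zero {h : E → List E → M} {l : List E} (H : psum h l ≠ 0) :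
    ∃ x r, (x :: r).Perm l ∧ h x r ≠ 0 := by
  by_contra hc
  push Not at hc
  apply H
  have : psum h l = psum (fun _ _ => (0 : M)) l := psum_congr (fun x r hx => hc x r hx)
  rw [this]
  have := psum_neg (fun _ _ => (0 : M)) l
  clear * -
  induction l with
  | nil => rfl
  | cons a l ih => simp [psum, ih]

/-- Alternation of a function on words of length `n`. -/
def alt : ℕ → (List E → M) → List E → M
  | 0, g, [] => g []
  | 0, _, _ :: _ => 0
  | n + 1, g, l => psum (fun x r => alt n (fun m => g (x :: m)) r) l

theorem alt_map {F : Type*} (e : F → E) (n : ℕ) (g : List E → M) (l : List F) :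
    alt n g (l.map e) = alt n (fun m => g (m.map e)) l := by
  induction n generalizing g l with
  | zero => cases l <;> rfl
  | succ n ih =>
    simp only [alt, psum_map, ih, List.map_cons]

/-- The alternation is alternating. -/
theorem alt_alt (n : ℕ) (g : List E → M) : Alt (alt n g) := by
  induction n generalizing g with
  | zero =>
    intro p a b q
    cases p <;> simp [alt]
  | succ n ih =>
    have := psum_alt (fun x r => alt n (fun m => g (x :: m)) r) (fun x => ih _)
    exact this

theorem exists_of_alt_ne_zero {n : ℕ} {g : List E → M} {l : List E}
    (H : alt n g l ≠ 0) : ∃ r, r.Perm l ∧ g r ≠ 0 := by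
  induction n generalizing g l with
  | zero =>
    cases l with
    | nil => exact ⟨[], List.Perm.refl _, H⟩
    | cons a l => exact absurd rfl H
  | succ n ih =>
    obtain ⟨x, r, hx, h⟩ := exists_of_psum_ne_zero H
    obtain ⟨r', hr', h'⟩ := ih h
    exact ⟨x :: r', (hr'.cons x).trans hx, h'⟩

end Words

end FiveTor

namespace FiveTor

open MatchPaper

section Signs

variable {V : Type*}

/-- Comparison sign of two letters. -/
def cs (rk : V → ℕ) (a b : V) : ℤ := if rk a < rk b then 1 else if rk b < rk a then -1 else 0

theorem cs_anti (rk : V → ℕ) (a b : V) : cs rk a b = - cs rk b a := by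
  unfold cs
  split_ifs <;> omega

/-- The sign of a word. -/
def sg (rk : V → ℕ) : List V → ℤ
  | [] => 1
  | a :: l => (l.map (cs rk a)).prod * sg rk l

theorem sg_alt (rk : V → ℕ) : Alt (sg rk) := by
  intro p a b q
  induction p with
  | nil =>
    simp only [List.nil_append, sg, List.map_cons, List.prod_cons]
    rw [cs_anti rk a b]
    ring
  | cons y p ih =>
    simp only [List.cons_append, sg, List.map_append, List.map_cons, List.prod_append,
      List.prod_cons]
    rw [ih]
    ring

theorem sg_sorted (rk : V → ℕ) {l : List V} (hl : l.Pairwise (fun a b => rk a < rk b)) :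
    sg rk l = 1 := by
  induction l with
  | nil => rfl
  | cons a l ih =>
    rw [List.pairwise_cons] at hl
    have : l.map (cs rk a) = l.map (fun _ => 1) := by
      apply List.map_congr_left
      intro b hb
      simp [cs, hl.1 b hb]
    simp [sg, this, ih hl.2]

theorem sg_map {W : Type*} (rk : V → ℕ) (rk' : W → ℕ) (f : V → W)
    (h : ∀ a b, rk' (f a) < rk' (f b) ↔ rk a < rk b) (l : List V) :
    sg rk' (l.map f) = sg rk l := by
  induction l with
  | nil => rfl
  | cons a l ih =>
    simp only [List.map_cons, sg, ih, List.map_map]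
    congr 3
    funext b
    simp [cs, h]

theorem exists_sorted (rk : V → ℕ) (hrk : Function.Injective rk) {l : List V} (hl : l.Nodup) :
    ∃ l' : List V, l.Perm l' ∧ l'.Pairwise (fun a b => rk a < rk b) := by
  classical
  refine ⟨l.insertionSort (fun a b => rk a ≤ rk b), (List.perm_insertionSort _ l).symm, ?_⟩
  have h1 := List.pairwise_insertionSort (fun a b => rk a ≤ rk b) l
  have h2 : (l.insertionSort (fun a b => rk a ≤ rk b)).Nodup :=
    (List.perm_insertionSort _ l).nodup_iff.2 hl
  exact (h1.and h2).imp (fun {a b} h => lt_of_le_of_ne h.1 (fun e => h.2 (hrk e)))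

variable [DecidableEq V]

/-- The oriented simplex of a word. -/
noncomputable def wd (rk : V → ℕ) (K : Finset V → Prop) (c : ℕ) (l : List V) : SChain ℤ K c :=
  sg rk l • basisOrZero ℤ K c l.toFinset

theorem wd_alt (rk : V → ℕ) (K : Finset V → Prop) (c : ℕ) : Alt (wd rk K c) := by
  intro p a b q
  unfold wd
  rw [sg_alt rk p a b q, neg_smul]
  congr 3
  ext x
  simp
  tauto

theorem psum_sorted {M : Type*} [AddCommGroup M] (rk : V → ℕ) (H : V → List V → M) {l : List V}
    (hl : l.Pairwise (fun a b => rk a < rk b)) :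
    psum H l = ∑ v ∈ l.toFinset,
      (-1 : ℤ) ^ (l.toFinset.filter fun u => rk u < rk v).card • H v (l.erase v) := by
  induction l generalizing H with
  | nil => simp [psum]
  | cons a l ih =>
    rw [List.pairwise_cons] at hl
    have ha : a ∉ l.toFinset := by
      intro h
      exact lt_irrefl _ (hl.1 a (List.mem_toFinset.1 h))
    simp only [psum]
    rw [ih _ hl.2, List.toFinset_cons, Finset.sum_insert ha]
    have h0 : ((insert a l.toFinset).filter fun u => rk u < rk a) = ∅ := by
      ext u
      simp only [Finset.mem_filter, Finset.mem_insert, List.mem_toFinset, Finset.notMem_empty,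
        iff_false, not_and]
      rintro (rfl | h)
      · simp
      · have := hl.1 u h
        omega
    rw [h0, List.erase_cons_head]
    simp only [Finset.card_empty, pow_zero, one_smul]
    rw [sub_eq_add_neg, ← Finset.sum_neg_distrib]
    congr 1
    apply Finset.sum_congr rfl
    intro v hv
    have hv' := hl.1 v (List.mem_toFinset.1 hv)
    have hne : a ≠ v := by
      rintro rfl
      exact ha hv
    rw [Finset.filter_insert, if_pos hv', Finset.card_insert_of_notMem (by simpa using fun h => absurd h (by simpa using ha)),
      pow_succ, List.erase_cons_tail (by simpa using hne)]
    simp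

theorem bdry_basis (rk : V → ℕ) (K : Finset V → Prop) (c : ℕ) {τ : Finset V}
    (h : K τ ∧ τ.card = c + 1) :
    bdry ℤ rk K c (basisOrZero ℤ K (c + 1) τ) =
      ∑ v ∈ τ, ((-1 : ℤ) ^ ((τ.filter fun u => rk u < rk v).card) •
        basisOrZero ℤ K c (τ.erase v)) := by
  rw [basisOrZero, dif_pos h, bdry, Finsupp.lsum_single]
  simp

theorem chain_tf {V : Type*} (K : Finset V → Prop) (c : ℕ) (m : SChain ℤ K c) (h : m = -m) : m = 0 := by
  ext x
  have := DFunLike.congr_fun h x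
  simp only [Finsupp.coe_neg, Pi.neg_apply] at this
  simp only [Finsupp.coe_zero, Pi.zero_apply]
  omega

theorem bdry_wd (rk : V → ℕ) (hrk : Function.Injective rk) (K : Finset V → Prop) (c : ℕ)
    {l : List V} (hK : K l.toFinset) (hl : l.length = c + 1) :
    bdry ℤ rk K c (wd rk K (c + 1) l) = psum (fun _ => wd rk K c) l := by
  classical
  let k : List V → SChain ℤ K c := fun l => if K l.toFinset ∧ l.length = c + 1 then
    bdry ℤ rk K c (wd rk K (c + 1) l) - psum (fun _ => wd rk K c) l else 0
  have hk : Alt k := by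
    intro p a b q
    have e : (p ++ a :: b :: q).toFinset = (p ++ b :: a :: q).toFinset := by
      ext x
      simp
      tauto
    have e' : (p ++ a :: b :: q).length = (p ++ b :: a :: q).length := by simp
    simp only [k, e, e']
    split_ifs
    · rw [wd_alt rk K (c + 1) p a b q, psum_alt _ (fun _ => wd_alt rk K c) p a b q, map_neg]
      abel
    · simp
  suffices h : k l = 0 by
    simp only [k] at h
    rw [if_pos ⟨hK, hl⟩, sub_eq_zero] at h
    exact h
  by_cases hn : l.Nodup
  · obtain ⟨l', hp, hs⟩ := exists_sorted rk hrk hn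
    apply hk.zero_of_perm hp
    have hn' : l'.Nodup := hp.nodup_iff.1 hn
    have hK' : K l'.toFinset := by rwa [← List.toFinset_eq_of_perm _ _ hp]
    have hl' : l'.length = c + 1 := by rw [← hp.length_eq, hl]
    simp only [k]
    rw [if_pos ⟨hK', hl'⟩, sub_eq_zero, psum_sorted rk _ hs, wd, sg_sorted rk hs, one_smul,
      bdry_basis rk K c ⟨hK', by rw [List.toFinset_card_of_nodup hn', hl']⟩]
    apply Finset.sum_congr rfl
    intro v hv
    have hs' : (l'.erase v).Pairwise (fun a b => rk a < rk b) :=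
      hs.sublist List.erase_sublist
    rw [wd, sg_sorted rk hs', one_smul]
    congr 2
    ext x
    simp [hn'.mem_erase_iff]
  · exact hk.zero_of_not_nodup (chain_tf K c) hn

end Signs

end FiveTor

namespace FiveTor

open MatchPaper

section Cochains

variable {V : Type*} [DecidableEq V] {A : Type*} [AddCommGroup A]

theorem sg_unit (rk : V → ℕ) (hrk : Function.Injective rk) {l : List V} (hl : l.Nodup) :
    sg rk l = 1 ∨ sg rk l = -1 := by
  induction l with
  | nil => exact Or.inl rfl
  | cons a l ih =>
    rw [List.nodup_cons] at hl
    have h1 : (l.map (cs rk a)).prod = 1 ∨ (l.map (cs rk a)).prod = -1 := by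
      have ha := hl.1
      clear ih hl
      induction l with
      | nil => simp
      | cons b l ih =>
        rw [List.mem_cons, not_or] at ha
        have hb : cs rk a b = 1 ∨ cs rk a b = -1 := by
          have : rk a ≠ rk b := fun e => ha.1 (hrk e)
          unfold cs
          split_ifs <;> first | omega | simp
        rw [List.map_cons, List.prod_cons]
        rcases hb with h | h <;> rcases ih ha.2 with h' | h' <;> simp [h, h']
    rw [sg]
    rcases h1 with h | h <;> rcases ih hl.2 with h' | h' <;> simp [h, h']

/-- The cochain of an alternating function on words. -/
noncomputable def cochain (rk : V → ℕ) (K : Finset V → Prop) (c : ℕ) (F : List V → A) :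
    SChain ℤ K c →ₗ[ℤ] A :=
  Finsupp.lsum ℤ fun σ => LinearMap.toSpanSingleton ℤ _ (sg rk σ.1.toList • F σ.1.toList)

theorem cochain_wd (rk : V → ℕ) (hrk : Function.Injective rk) (K : Finset V → Prop) (c : ℕ)
    {F : List V → A} (hF : Alt F) {l : List V} (hK : K l.toFinset) (hl : l.length = c)
    (hn : l.Nodup) : cochain rk K c F (wd rk K c l) = F l := by
  have hc : l.toFinset.card = c := by rw [List.toFinset_card_of_nodup hn, hl]
  rw [wd, map_smul, basisOrZero, dif_pos ⟨hK, hc⟩, cochain, Finsupp.lsum_single,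
    LinearMap.toSpanSingleton_apply, one_smul]
  have hp : l.Perm l.toFinset.toList := by
    rw [List.perm_ext_iff_of_nodup hn (Finset.nodup_toList _)]
    simp
  have hu := sg_unit rk hrk (Finset.nodup_toList l.toFinset)
  show sg rk l • sg rk l.toFinset.toList • F l.toFinset.toList = F l
  generalize l.toFinset.toList = L at hp hu
  have hk : Alt (fun m => F m - sg rk m • (sg rk L • F L)) := by
    intro p a b q
    show _ - _ = - (_ - _)
    rw [hF p a b q, sg_alt rk p a b q, neg_smul]
    abel
  have h0 := hk.zero_of_perm hp (by
    rcases hu with h | h <;> simp [h])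
  exact (sub_eq_zero.1 h0).symm

theorem cochain_bdry (rk : V → ℕ) (hrk : Function.Injective rk) (K : Finset V → Prop)
    (hK : ∀ s t, K t → s ⊆ t → K s) (c : ℕ)
    {F : List V → A} (hF : Alt F)
    (hc : ∀ l : List V, K l.toFinset → l.Nodup → l.length = c + 1 → psum (fun _ => F) l = 0)
    (x : SChain ℤ K (c + 1)) : cochain rk K c F (bdry ℤ rk K c x) = 0 := by
  suffices h : (cochain rk K c F).comp (bdry ℤ rk K c) = 0 by
    exact DFunLike.congr_fun h x
  apply Finsupp.lhom_ext
  intro σ b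
  have hb : Finsupp.single σ b = b • basisOrZero ℤ K (c + 1) σ.1 := by
    rw [basisOrZero, dif_pos σ.2]
    simp
  rw [hb, map_smul, LinearMap.zero_apply, LinearMap.comp_apply]
  have hn := Finset.nodup_toList σ.1
  have hf : σ.1.toList.toFinset = σ.1 := Finset.toList_toFinset _
  have hlen : σ.1.toList.length = c + 1 := by rw [Finset.length_toList, σ.2.2]
  have h1 := bdry_wd rk hrk K c (l := σ.1.toList) (by rw [hf]; exact σ.2.1) hlen
  have h2 := congrArg (cochain rk K c F) h1
  have h3 := psum_hom (cochain rk K c F).toAddMonoidHom (fun _ => wd rk K c) σ.1.toList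
  simp only [LinearMap.toAddMonoidHom_coe] at h3
  rw [h3, psum_congr (h' := fun _ => F) (by
    intro y r hy
    have hyn := hy.nodup_iff.2 hn
    rw [List.nodup_cons] at hyn
    apply cochain_wd rk hrk K c hF _ _ hyn.2
    · apply hK _ _ σ.2.1
      intro z hz
      rw [← Finset.mem_toList, ← hy.mem_iff]
      exact List.mem_cons_of_mem _ (List.mem_toFinset.1 hz)
    · have := hy.length_eq
      simp only [List.length_cons] at this
      omega), hc _ (by rw [hf]; exact σ.2.1) hn hlen, wd, hf, map_smul, map_smul] at h2
  rcases sg_unit rk hrk hn with h | h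
  · rw [h, one_smul] at h2
    rw [h2, smul_zero]
  · rw [h, neg_one_smul, neg_eq_zero] at h2
    rw [h2, smul_zero]

end Cochains

end FiveTor

namespace FiveTor

open MatchPaper

/-- Edges of the complete graph on fourteen vertices. -/
abbrev Ed14 : Type := Fin 14 × Fin 14

/-- The block of a vertex. -/
def blk (v : Fin 14) : Fin 7 := ⟨v.val / 2, by omega⟩

/-- Two edges meet a common block. -/
def nb (a b : Ed14) : Bool :=
  decide (blk a.1 = blk b.1 ∨ blk a.1 = blk b.2 ∨ blk a.2 = blk b.1 ∨ blk a.2 = blk b.2)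

/-- An edge inside a block. -/
def lp (a : Ed14) : Bool := decide (blk a.1 = blk a.2)

/-- Indicator of a path with four edges followed by a separate edge. -/
def indic {X : Type*} (n : X → X → Bool) (p : X → Bool) : List X → ZMod 5
  | [a, b, c, d, e] =>
    if n a b && n b c && n c d && !n a c && !n a d && !n b d && !n a e && !n b e && !n c e
      && !n d e && !p e then 1 else 0
  | _ => 0

theorem indic_map {X Y : Type*} (n : X → X → Bool) (p : X → Bool) (f : Y → X) (l : List Y) :
    indic n p (l.map f) = indic (fun a b => n (f a) (f b)) (fun a => p (f a)) l := by
  match l with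
  | [] => rfl
  | [_] => rfl
  | [_, _] => rfl
  | [_, _, _] => rfl
  | [_, _, _, _] => rfl
  | [_, _, _, _, _] => rfl
  | _ :: _ :: _ :: _ :: _ :: _ :: _ => rfl

theorem indic_ne_zero {X : Type*} {n : X → X → Bool} {p : X → Bool} {l : List X}
    (h : indic n p l ≠ 0) : ∃ a b c d e, l = [a, b, c, d, e] ∧ n a b = true ∧ n b c = true ∧
      n c d = true ∧ n a c = false ∧ n a d = false ∧ n b d = false ∧ n a e = false ∧
      n b e = false ∧ n c e = false ∧ n d e = false ∧ p e = false := by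
  match l with
  | [] => exact absurd rfl h
  | [_] => exact absurd rfl h
  | [_, _] => exact absurd rfl h
  | [_, _, _] => exact absurd rfl h
  | [_, _, _, _] => exact absurd rfl h
  | _ :: _ :: _ :: _ :: _ :: _ :: _ => exact absurd rfl h
  | [a, b, c, d, e] =>
    refine ⟨a, b, c, d, e, rfl, ?_⟩
    simp only [indic] at h
    have := (ite_ne_right_iff.1 h).1
    simp only [Bool.and_eq_true, Bool.not_eq_true'] at this
    tauto

/-- The alternating function underlying the cocycle. -/
def F5 : List Ed14 → ZMod 5 := alt 5 (indic nb lp)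

/-- The edge `e` joins the blocks `P` and `Q`. -/
def Joins (e : Ed14) (P Q : Fin 7) : Prop :=
  (blk e.1 = P ∧ blk e.2 = Q) ∨ (blk e.1 = Q ∧ blk e.2 = P)

theorem Joins.symm {e : Ed14} {P Q : Fin 7} (h : Joins e P Q) : Joins e Q P := Or.symm h

theorem Joins.nb_eq {e e' : Ed14} {P Q P' Q' : Fin 7} (h : Joins e P Q) (h' : Joins e' P' Q') :
    nb e e' = decide (P = P' ∨ P = Q' ∨ Q = P' ∨ Q = Q') := by
  unfold nb
  rw [decide_eq_decide]
  rcases h with ⟨rfl, rfl⟩ | ⟨rfl, rfl⟩ <;> rcases h' with ⟨rfl, rfl⟩ | ⟨rfl, rfl⟩ <;> tauto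

theorem Joins.lp_eq {e : Ed14} {P Q : Fin 7} (h : Joins e P Q) : lp e = decide (P = Q) := by
  unfold lp
  rw [decide_eq_decide]
  rcases h with ⟨rfl, rfl⟩ | ⟨rfl, rfl⟩
  · rfl
  · exact eq_comm

theorem Joins.next {e e' : Ed14} {P Q : Fin 7} (h : Joins e P Q) (hn : nb e e' = true) :
    (∃ U, Joins e' P U) ∨ (∃ U, Joins e' Q U) := by
  unfold nb at hn
  rw [decide_eq_true_eq] at hn
  unfold Joins at *
  rcases h with ⟨rfl, rfl⟩ | ⟨rfl, rfl⟩ <;> rcases hn with h | h | h | h <;> simp [h]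

/-- Edges without common end. -/
def Disj (e e' : Ed14) : Prop := e.1 ≠ e'.1 ∧ e.1 ≠ e'.2 ∧ e.2 ≠ e'.1 ∧ e.2 ≠ e'.2

theorem tri_blk {u v w : Fin 14} (h1 : u ≠ v) (h2 : u ≠ w) (h3 : v ≠ w) (h4 : blk u = blk v)
    (h5 : blk u = blk w) : False := by
  simp only [blk, Fin.mk.injEq] at h4 h5
  omega

theorem Joins.loop {e e' : Ed14} {P Q Q' : Fin 7} (he : e.1 ≠ e.2) (hd : Disj e e')
    (h : Joins e P Q) (h' : Joins e' P Q') : P ≠ Q := by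
  intro hPQ
  subst hPQ
  obtain ⟨d1, d2, d3, d4⟩ := hd
  have h1 : blk e.1 = P := by rcases h with h | h <;> simp [h]
  have h2 : blk e.2 = P := by rcases h with h | h <;> simp [h]
  rcases h' with ⟨h3, -⟩ | ⟨-, h3⟩
  · exact tri_blk he d1 d3 (h1.trans h2.symm) (h1.trans h3.symm)
  · exact tri_blk he d2 d4 (h1.trans h2.symm) (h1.trans h3.symm)

theorem Joins.three {e e' x : Ed14} {P Q Q' U V : Fin 7} (hd : Disj e e') (hx : Disj x e)
    (hx' : Disj x e') (h : Joins e P Q) (h' : Joins e' P Q') (hU : Joins x U V) : U ≠ P := by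
  intro hUP
  subst hUP
  obtain ⟨d1, d2, d3, d4⟩ := hd
  obtain ⟨x1, x2, x3, x4⟩ := hx
  obtain ⟨y1, y2, y3, y4⟩ := hx'
  rcases h with ⟨h, -⟩ | ⟨-, h⟩ <;> rcases h' with ⟨h', -⟩ | ⟨-, h'⟩ <;>
    rcases hU with ⟨hU, -⟩ | ⟨-, hU⟩ <;>
    exact tri_blk (by assumption) (by assumption) (by assumption) (hU.trans h.symm)
      (hU.trans h'.symm)

/-- Adjacency table of a path with four edges `1,2,3,4`, a separate edge `5` and an edge `0` with
prescribed neighbours. -/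
def tbl (b1 b4 b5 : Bool) (i j : Fin 6) : Bool :=
  i == j || [(1, 2), (2, 3), (3, 4)].contains (i.val, j.val) ||
    [(2, 1), (3, 2), (4, 3)].contains (i.val, j.val) ||
    (b1 && [(0, 1), (1, 0)].contains (i.val, j.val)) ||
    (b4 && [(0, 4), (4, 0)].contains (i.val, j.val)) ||
    (b5 && [(0, 5), (5, 0)].contains (i.val, j.val))

theorem eval1 : psum (fun _ => alt 5 (indic (tbl true true false) (fun _ => false)))
    [0, 1, 2, 3, 4, 5] = 0 := by
  decide +kernel

theorem eval2 : psum (fun _ => alt 5 (indic (tbl true false true) (fun _ => false)))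
    [0, 1, 2, 3, 4, 5] = 0 := by
  decide +kernel

theorem eval3 : psum (fun _ => alt 5 (indic (tbl false true true) (fun _ => false)))
    [0, 1, 2, 3, 4, 5] = 0 := by
  decide +kernel

theorem eval4 : psum (fun _ => alt 5 (indic (tbl false false true) (fun _ => false)))
    [0, 1, 2, 3, 4, 5] = 0 := by
  decide +kernel

theorem nb_comm (a b : Ed14) : nb a b = nb b a := by
  unfold nb
  rw [decide_eq_decide]
  constructor <;> rintro (h | h | h | h) <;> simp [h]

theorem nb_self (a : Ed14) : nb a a = true := by
  simp [nb]

theorem psum_F5_table {x a b c d e : Ed14} (b1 b4 b5 : Bool)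
    (H : psum (fun _ => alt 5 (indic (tbl b1 b4 b5) (fun _ => false))) [0, 1, 2, 3, 4, 5] = 0)
    (hab : nb a b = true) (hbc : nb b c = true) (hcd : nb c d = true) (hac : nb a c = false)
    (had : nb a d = false) (hbd : nb b d = false) (hae : nb a e = false) (hbe : nb b e = false)
    (hce : nb c e = false) (hde : nb d e = false) (pa : lp a = false) (pb : lp b = false)
    (pc : lp c = false) (pd : lp d = false) (pe : lp e = false) (px : lp x = false)
    (hxa : nb x a = b1) (hxb : nb x b = false) (hxc : nb x c = false) (hxd : nb x d = b4)
    (hxe : nb x e = b5) : psum (fun _ => F5) [x, a, b, c, d, e] = 0 := by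
  let f : Fin 6 → Ed14 := ![x, a, b, c, d, e]
  have hf : [x, a, b, c, d, e] = List.map f [0, 1, 2, 3, 4, 5] := rfl
  have hn : (fun i j => nb (f i) (f j)) = tbl b1 b4 b5 := by
    funext i j
    have := nb_comm
    fin_cases i <;> fin_cases j <;>
      simp [f, tbl, nb_self, hab, hbc, hcd, hac, had, hbd, hae, hbe, hce, hde, hxa, hxb, hxc,
        hxd, hxe, nb_comm b a, nb_comm c b, nb_comm d c, nb_comm c a, nb_comm d a, nb_comm d b,
        nb_comm e a, nb_comm e b, nb_comm e c, nb_comm e d, nb_comm a x, nb_comm b x,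
        nb_comm c x, nb_comm d x, nb_comm e x]
  have hp : (fun i => lp (f i)) = fun _ => false := by
    funext i
    fin_cases i <;> simp [f, pa, pb, pc, pd, pe, px]
  rw [hf, psum_map]
  simp only [F5, alt_map, indic_map]
  rw [hn, hp]
  exact H

end FiveTor

namespace FiveTor

open MatchPaper

theorem seven_cover {B0 B1 B2 B3 B4 C D : Fin 7} (h : [B0, B1, B2, B3, B4, C, D].Nodup)
    (X : Fin 7) : X = B0 ∨ X = B1 ∨ X = B2 ∨ X = B3 ∨ X = B4 ∨ X = C ∨ X = D := by
  have h1 : [B0, B1, B2, B3, B4, C, D].toFinset = Finset.univ := by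
    apply Finset.eq_univ_of_card
    rw [List.toFinset_card_of_nodup h]
    rfl
  have h2 : X ∈ [B0, B1, B2, B3, B4, C, D].toFinset := by
    rw [h1]
    exact Finset.mem_univ _
  simpa using h2

set_option linter.unusedSimpArgs false in
theorem psum_F5_of_path {x a b c d e : Ed14}
    (nl : ∀ y ∈ [x, a, b, c, d, e], y.1 ≠ y.2)
    (dj : [x, a, b, c, d, e].Pairwise Disj)
    (hab : nb a b = true) (hbc : nb b c = true) (hcd : nb c d = true) (hac : nb a c = false)
    (had : nb a d = false) (hbd : nb b d = false) (hae : nb a e = false) (hbe : nb b e = false)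
    (hce : nb c e = false) (hde : nb d e = false) (pe : lp e = false) :
    psum (fun _ => F5) [x, a, b, c, d, e] = 0 := by
  have sy : ∀ {y z : Ed14}, Disj y z → Disj z y := by
    rintro y z ⟨h1, h2, h3, h4⟩
    exact ⟨h1.symm, h3.symm, h2.symm, h4.symm⟩
  simp only [List.pairwise_cons, List.mem_cons, List.not_mem_nil, or_false, forall_eq_or_imp,
    forall_eq] at dj nl
  obtain ⟨⟨dxa, dxb, dxc, dxd, dxe⟩, ⟨dab, dac, dad, dae⟩, ⟨dbc, dbd, dbe⟩, ⟨dcd, dce⟩, dde, -⟩ :=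
    dj
  obtain ⟨nx, na, nb', nc, nd, ne⟩ := nl
  have Ja0 : Joins a (blk a.1) (blk a.2) := Or.inl ⟨rfl, rfl⟩
  obtain ⟨B0, B1, B2, Ja, Jb⟩ : ∃ B0 B1 B2, Joins a B0 B1 ∧ Joins b B1 B2 := by
    rcases Ja0.next hab with ⟨U, hU⟩ | ⟨U, hU⟩
    · exact ⟨_, _, _, Ja0.symm, hU⟩
    · exact ⟨_, _, _, Ja0, hU⟩
  obtain ⟨B3, Jc⟩ : ∃ B3, Joins c B2 B3 := by
    rcases Jb.next hbc with ⟨U, hU⟩ | h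
    · rw [Ja.nb_eq hU] at hac
      simp at hac
    · exact h
  obtain ⟨B4, Jd⟩ : ∃ B4, Joins d B3 B4 := by
    rcases Jc.next hcd with ⟨U, hU⟩ | h
    · rw [Jb.nb_eq hU] at hbd
      simp at hbd
    · exact h
  obtain ⟨C, D, Je⟩ : ∃ C D, Joins e C D := ⟨_, _, Or.inl ⟨rfl, rfl⟩⟩
  obtain ⟨X, Y, Jx⟩ : ∃ X Y, Joins x X Y := ⟨_, _, Or.inl ⟨rfl, rfl⟩⟩
  have n01 : B0 ≠ B1 := (Ja.symm.loop na dab Jb).symm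
  have n34 : B3 ≠ B4 := Jd.loop nd (sy dcd) Jc.symm
  have hac' := hac
  have had' := had
  have hbd' := hbd
  have hae' := hae
  have hbe' := hbe
  have hce' := hce
  have hde' := hde
  have pe' := pe
  rw [Ja.nb_eq Jc, decide_eq_false_iff_not] at hac'
  rw [Ja.nb_eq Jd, decide_eq_false_iff_not] at had'
  rw [Jb.nb_eq Jd, decide_eq_false_iff_not] at hbd'
  rw [Ja.nb_eq Je, decide_eq_false_iff_not] at hae'
  rw [Jb.nb_eq Je, decide_eq_false_iff_not] at hbe'
  rw [Jc.nb_eq Je, decide_eq_false_iff_not] at hce'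
  rw [Jd.nb_eq Je, decide_eq_false_iff_not] at hde'
  rw [Je.lp_eq, decide_eq_false_iff_not] at pe'
  push Not at hac' had' hbd' hae' hbe' hce' hde'
  obtain ⟨n02, n03, n12, n13⟩ := hac'
  obtain ⟨-, n04, -, n14⟩ := had'
  obtain ⟨-, -, n23, n24⟩ := hbd'
  obtain ⟨n0C, n0D, n1C, n1D⟩ := hae'
  obtain ⟨-, -, n2C, n2D⟩ := hbe'
  obtain ⟨-, -, n3C, n3D⟩ := hce'
  obtain ⟨-, -, n4C, n4D⟩ := hde'
  have cov := seven_cover (B0 := B0) (B1 := B1) (B2 := B2) (B3 := B3) (B4 := B4) (C := C) (D := D)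
    (by simp; tauto)
  have restr : ∀ U V, Joins x U V → (U = B0 ∨ U = B4 ∨ U = C ∨ U = D) := by
    intro U V hU
    have h1 := Joins.three dab dxa dxb Ja.symm Jb hU
    have h2 := Joins.three dbc dxb dxc Jb.symm Jc hU
    have h3 := Joins.three dcd dxc dxd Jc.symm Jd hU
    have := cov U
    tauto
  have hX := restr X Y Jx
  have hY := restr Y X Jx.symm
  have hXY : X ≠ Y := by
    rcases hX with h | h | h | h
    · subst h
      exact Jx.loop nx dxa Ja
    · subst h
      exact Jx.loop nx dxd Jd.symm
    · subst h
      exact Jx.loop nx dxe Je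
    · subst h
      exact Jx.loop nx dxe Je.symm
  have key : ∀ b1 b4 b5,
      psum (fun _ => alt 5 (indic (tbl b1 b4 b5) (fun _ => false))) [0, 1, 2, 3, 4, 5] = 0 →
      nb x a = b1 → nb x b = false → nb x c = false → nb x d = b4 → nb x e = b5 →
      psum (fun _ => F5) [x, a, b, c, d, e] = 0 := by
    intro b1 b4 b5 H q1 q2 q3 q4 q5
    exact psum_F5_table b1 b4 b5 H hab hbc hcd hac had hbd hae hbe hce hde
      (by rw [Ja.lp_eq]; simpa using n01) (by rw [Jb.lp_eq]; simpa using n12)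
      (by rw [Jc.lp_eq]; simpa using n23) (by rw [Jd.lp_eq]; simpa using n34) pe
      (by rw [Jx.lp_eq]; simpa using hXY) q1 q2 q3 q4 q5
  rw [Jx.nb_eq Ja, Jx.nb_eq Jb, Jx.nb_eq Jc, Jx.nb_eq Jd, Jx.nb_eq Je] at key
  have k1 := key _ _ _ eval1
  have k2 := key _ _ _ eval2
  have k3 := key _ _ _ eval3
  have k4 := key _ _ _ eval4
  simp only [decide_eq_true_eq, decide_eq_false_iff_not] at k1 k2 k3 k4
  clear key hab hbc hcd hac had hbd hae hbe hce hde restr cov Ja0 Ja Jb Jc Jd Je Jx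
    dxa dxb dxc dxd dxe dab dac dad dae dbc dbd dbe dcd dce dde nx na nb' nc nd ne
  rcases hX with h | h | h | h <;> rcases hY with h' | h' | h' | h' <;> subst h <;> subst h' <;>
    first
    | exact absurd rfl hXY
    | (apply k1 <;> simp [n01, n02, n03, n04, n0C, n0D, n12, n13, n14, n1C, n1D, n23, n24, n2C,
        n2D, n34, n3C, n3D, n4C, n4D, pe', n01.symm, n02.symm, n03.symm, n04.symm, n0C.symm,
        n0D.symm, n12.symm, n13.symm, n14.symm, n1C.symm, n1D.symm, n23.symm, n24.symm, n2C.symm,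
        n2D.symm, n34.symm, n3C.symm, n3D.symm, n4C.symm, n4D.symm, Ne.symm pe'] ; done)
    | (apply k2 <;> simp [n01, n02, n03, n04, n0C, n0D, n12, n13, n14, n1C, n1D, n23, n24, n2C,
        n2D, n34, n3C, n3D, n4C, n4D, pe', n01.symm, n02.symm, n03.symm, n04.symm, n0C.symm,
        n0D.symm, n12.symm, n13.symm, n14.symm, n1C.symm, n1D.symm, n23.symm, n24.symm, n2C.symm,
        n2D.symm, n34.symm, n3C.symm, n3D.symm, n4C.symm, n4D.symm, Ne.symm pe'] ; done)
    | (apply k3 <;> simp [n01, n02, n03, n04, n0C, n0D, n12, n13, n14, n1C, n1D, n23, n24, n2C,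
        n2D, n34, n3C, n3D, n4C, n4D, pe', n01.symm, n02.symm, n03.symm, n04.symm, n0C.symm,
        n0D.symm, n12.symm, n13.symm, n14.symm, n1C.symm, n1D.symm, n23.symm, n24.symm, n2C.symm,
        n2D.symm, n34.symm, n3C.symm, n3D.symm, n4C.symm, n4D.symm, Ne.symm pe'] ; done)
    | (apply k4 <;> simp [n01, n02, n03, n04, n0C, n0D, n12, n13, n14, n1C, n1D, n23, n24, n2C,
        n2D, n34, n3C, n3D, n4C, n4D, pe', n01.symm, n02.symm, n03.symm, n04.symm, n0C.symm,
        n0D.symm, n12.symm, n13.symm, n14.symm, n1C.symm, n1D.symm, n23.symm, n24.symm, n2C.symm,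
        n2D.symm, n34.symm, n3C.symm, n3D.symm, n4C.symm, n4D.symm, Ne.symm pe'] ; done)

theorem F5_alt : Alt F5 := alt_alt 5 _

theorem matching_lt {m : ℕ} {l : List (Fin m × Fin m)} (hl : IsMatching m l.toFinset) :
    ∀ y ∈ l, y.1 < y.2 := fun y hy => hl.1 y (List.mem_toFinset.2 hy)

theorem matching_pairwise {l : List Ed14} (hl : IsMatching 14 l.toFinset) (hn : l.Nodup) :
    l.Pairwise Disj := by
  apply List.Pairwise.imp_of_mem _ hn
  intro y z hy hz hyz
  exact hl.2 y (List.mem_toFinset.2 hy) z (List.mem_toFinset.2 hz) hyz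

theorem F5_cocycle (l : List Ed14) (hl : IsMatching 14 l.toFinset) (hn : l.Nodup) :
    psum (fun _ => F5) l = 0 := by
  by_contra hc
  obtain ⟨x, r, hp, h⟩ := exists_of_psum_ne_zero hc
  obtain ⟨r', hp', h'⟩ := exists_of_alt_ne_zero h
  have hq : (x :: r').Perm l := (hp'.cons x).trans hp
  apply hc
  apply (psum_alt _ (fun _ => F5_alt)).zero_of_perm hq.symm
  have hl' : IsMatching 14 (x :: r').toFinset := by rwa [List.toFinset_eq_of_perm _ _ hq]
  have hn' : (x :: r').Nodup := hq.nodup_iff.2 hn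
  obtain ⟨a, b, c, d, e, rfl, h1, h2, h3, h4, h5, h6, h7, h8, h9, h10, h11⟩ := indic_ne_zero h'
  exact psum_F5_of_path (fun y hy => (matching_lt hl' y hy).ne) (matching_pairwise hl' hn')
    h1 h2 h3 h4 h5 h6 h7 h8 h9 h10 h11

theorem rankP_inj (m : ℕ) : Function.Injective (rankP m) := by
  rintro ⟨a, b⟩ ⟨c, d⟩ h
  simp only [rankP] at h
  have h1 : a.val = c.val := by
    have ha : (a.val * m + b.val) / m = a.val := by
      rw [mul_comm, Nat.mul_add_div (by omega), Nat.div_eq_of_lt b.2, add_zero]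
    have hc : (c.val * m + d.val) / m = c.val := by
      rw [mul_comm, Nat.mul_add_div (by omega), Nat.div_eq_of_lt d.2, add_zero]
    rw [← ha, ← hc, h]
  rw [h1] at h
  have h2 : b.val = d.val := by omega
  ext <;> assumption

theorem matching_mono {m : ℕ} (s t : Finset (Fin m × Fin m)) (ht : IsMatching m t) (h : s ⊆ t) :
    IsMatching m s :=
  ⟨fun p hp => ht.1 p (h hp), fun p hp q hq => ht.2 p (h hp) q (h hq)⟩

/-- The cocycle modulo five. -/
noncomputable def fco : SChain ℤ (IsMatching 14) 5 →ₗ[ℤ] ZMod 5 :=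
  cochain (rankP 14) (IsMatching 14) 5 F5

theorem fco_bdry (x : SChain ℤ (IsMatching 14) 6) :
    fco (bdry ℤ (rankP 14) (IsMatching 14) 5 x) = 0 :=
  cochain_bdry (rankP 14) (rankP_inj 14) (IsMatching 14) matching_mono 5 F5_alt
    (fun l hl hn _ => F5_cocycle l hl hn) x

end FiveTor

namespace FiveTor

open MatchPaper

/-- The symmetry group: it preserves the partition into pairs and the coarser partition with
classes of size six, six and two, and fixes the last vertex. -/
def GG : Subgroup (Equiv.Perm (Fin 14)) where
  carrier := {g | (∀ x y : Fin 14, x.val / 2 = y.val / 2 ↔ (g x).val / 2 = (g y).val / 2) ∧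
    (∀ x y : Fin 14, x.val / 6 = y.val / 6 ↔ (g x).val / 6 = (g y).val / 6) ∧ g 13 = 13}
  mul_mem' := by
    rintro g h ⟨g1, g2, g3⟩ ⟨h1, h2, h3⟩
    refine ⟨fun x y => ?_, fun x y => ?_, ?_⟩
    · rw [h1, g1, Equiv.Perm.mul_apply, Equiv.Perm.mul_apply]
    · rw [h2, g2, Equiv.Perm.mul_apply, Equiv.Perm.mul_apply]
    · rw [Equiv.Perm.mul_apply, h3, g3]
  one_mem' := by simp
  inv_mem' := by
    rintro g ⟨g1, g2, g3⟩
    refine ⟨fun x y => ?_, fun x y => ?_, ?_⟩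
    · rw [g1 (g⁻¹ x) (g⁻¹ y)]
      simp
    · rw [g2 (g⁻¹ x) (g⁻¹ y)]
      simp
    · rw [Equiv.Perm.inv_eq_iff_eq, g3]

theorem mem_GG {g : Equiv.Perm (Fin 14)} : g ∈ GG ↔
    (∀ x y : Fin 14, x.val / 2 = y.val / 2 ↔ (g x).val / 2 = (g y).val / 2) ∧
    (∀ x y : Fin 14, x.val / 6 = y.val / 6 ↔ (g x).val / 6 = (g y).val / 6) ∧ g 13 = 13 :=
  Iff.rfl

noncomputable instance : Fintype GG := Fintype.ofFinite _

theorem five_dich {a b c d e : ℕ} (p1 : a = b ↔ b = c) (p2 : b = c ↔ c = d) (p3 : c = d ↔ d = e)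
    (p4 : d = e ↔ e = a) (q1 : a = c ↔ b = d) (q2 : b = d ↔ c = e) (q3 : c = e ↔ d = a)
    (q4 : d = a ↔ e = b) :
    (a = b ∧ a = c ∧ a = d ∧ a = e) ∨ (a ≠ b ∧ a ≠ c ∧ a ≠ d ∧ a ≠ e ∧ b ≠ c ∧ b ≠ d ∧ b ≠ e ∧
      c ≠ d ∧ c ≠ e ∧ d ≠ e) := by
  by_cases h1 : a = b
  · left
    have h2 := p1.1 h1
    have h3 := p2.1 h2
    have h4 := p3.1 h3
    omega
  · by_cases h2 : a = c
    · left
      have h3 := q1.1 h2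
      have h4 := q2.1 h3
      have h5 := q3.1 h4
      omega
    · right
      refine ⟨h1, h2, ?_, ?_, ?_, ?_, ?_, ?_, ?_, ?_⟩
      · intro h
        exact h2 (q1.2 (q2.2 (q3.2 h.symm)))
      · intro h
        exact h1 (p1.2 (p2.2 (p3.2 (p4.2 h.symm))))
      · intro h
        exact h1 (p1.2 h)
      · intro h
        exact h2 (q1.2 h)
      · intro h
        exact h2 (q1.2 (q2.2 (q3.2 (q4.2 h.symm))))
      · intro h
        exact h1 (p1.2 (p2.2 h))
      · intro h
        exact h2 (q1.2 (q2.2 h))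
      · intro h
        exact h1 (p1.2 (p2.2 (p3.2 h)))

theorem card_GG : ¬ 5 ∣ Fintype.card GG := by
  intro hd
  have : Fact (Nat.Prime 5) := ⟨by norm_num⟩
  obtain ⟨k, hk⟩ := exists_prime_orderOf_dvd_card 5 hd
  obtain ⟨h2, h6, -⟩ := mem_GG.1 k.2
  rw [← Subgroup.orderOf_coe] at hk
  generalize (k : Equiv.Perm (Fin 14)) = g at hk h2 h6
  have hne : g ≠ 1 := by
    rintro rfl
    simp at hk
  obtain ⟨x, hx⟩ : ∃ x, g x ≠ x := by
    by_contra hc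
    push Not at hc
    exact hne (Equiv.ext hc)
  have h5 : g ^ 5 = 1 := hk ▸ pow_orderOf_eq_one g
  have e5 : g (g (g (g (g x)))) = x := by
    have := DFunLike.congr_fun h5 x
    simpa [pow_succ] using this
  have dich : ∀ φ : Fin 14 → ℕ, (∀ u v, φ u = φ v ↔ φ (g u) = φ (g v)) → _ := fun φ h =>
    five_dich (a := φ x) (b := φ (g x)) (c := φ (g (g x))) (d := φ (g (g (g x))))
      (e := φ (g (g (g (g x))))) (h _ _) (h _ _) (h _ _) (by rw [h, e5]) (h _ _) (h _ _)
      (by rw [h, e5]) (by rw [h])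
  have k1 := dich (fun u => u.val) (fun u v => by
    simp only [← Fin.ext_iff]
    exact g.injective.eq_iff.symm)
  have k2 := dich (fun u => u.val / 2) h2
  have k6 := dich (fun u => u.val / 6) h6
  have hx' : x.val ≠ (g x).val := fun h => hx (Fin.ext h).symm
  have l0 := x.2
  have l1 := (g x).2
  have l2 := (g (g x)).2
  have l3 := (g (g (g x))).2
  have l4 := (g (g (g (g x)))).2
  clear dich
  generalize x.val = a at *
  generalize (g x).val = b at *
  generalize (g (g x)).val = c at *
  generalize (g (g (g x))).val = d at *
  generalize (g (g (g (g x)))).val = e at *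
  rcases k1 with k1 | k1
  · exact hx' k1.1
  · rcases k2 with k2 | k2
    · clear k6
      omega
    · rcases k6 with k6 | k6
      · omega
      · omega

theorem emap_mul (g h : Equiv.Perm (Fin 14)) (p : Ed14) : emap (g * h) p = emap g (emap h p) := by
  unfold emap
  rcases le_total (h p.1) (h p.2) with hl | hl
  · simp [min_eq_left hl, max_eq_right hl]
  · simp [min_eq_right hl, max_eq_left hl, min_comm, max_comm]

theorem emap_matching (g : Equiv.Perm (Fin 14)) {l : List Ed14} (hl : IsMatching 14 l.toFinset) :
    IsMatching 14 (l.map (emap g)).toFinset := by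
  have inj := fun u v => (g.injective.eq_iff (a := u) (b := v))
  constructor
  · intro p hp
    simp only [List.mem_toFinset, List.mem_map] at hp
    obtain ⟨q, hq, rfl⟩ := hp
    have := (matching_lt hl q hq).ne
    simp only [emap]
    rw [min_lt_max, Ne, inj]
    exact this
  · intro p hp q hq hpq
    simp only [List.mem_toFinset, List.mem_map] at hp hq
    obtain ⟨p, hp, rfl⟩ := hp
    obtain ⟨q, hq, rfl⟩ := hq
    have hne : p ≠ q := fun h => hpq (by rw [h])
    obtain ⟨h1, h2, h3, h4⟩ := hl.2 p (List.mem_toFinset.2 hp) q (List.mem_toFinset.2 hq) hne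
    simp only [emap]
    rcases le_total (g p.1) (g p.2) with h | h <;> rcases le_total (g q.1) (g q.2) with h' | h' <;>
      simp [min_eq_left, min_eq_right, max_eq_left, max_eq_right, h, h', h1, h2, h3, h4, inj]

theorem emap_nodup (g : Equiv.Perm (Fin 14)) {l : List Ed14} (hl : IsMatching 14 l.toFinset)
    (hn : l.Nodup) : (l.map (emap g)).Nodup := by
  apply hn.map_on
  intro p hp q hq hpq
  have h1 := matching_lt hl p hp
  have h2 := matching_lt hl q hq
  have e := congrArg (emap g⁻¹) hpq
  rw [← emap_mul, ← emap_mul, inv_mul_cancel] at e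
  simpa [emap, min_eq_left h1.le, max_eq_right h1.le, min_eq_left h2.le, max_eq_right h2.le,
    Prod.ext_iff] using e

/-- The symmetrised simplex of a word. -/
noncomputable def sym (c : ℕ) (l : List Ed14) : SChain ℤ (IsMatching 14) c :=
  ∑ g : GG, wd (rankP 14) (IsMatching 14) c (l.map (emap g.1))

theorem sym_alt (c : ℕ) : Alt (sym c) := by
  intro p a b q
  unfold sym
  rw [← Finset.sum_neg_distrib]
  apply Finset.sum_congr rfl
  intro g _
  simp only [List.map_append, List.map_cons]
  exact wd_alt _ _ _ _ _ _ _

theorem sym_inv (c : ℕ) (l : List Ed14) {h : Equiv.Perm (Fin 14)} (hh : h ∈ GG) :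
    sym c (l.map (emap h)) = sym c l := by
  unfold sym
  rw [← Equiv.sum_comp (Equiv.mulRight (⟨h, hh⟩ : GG))
    (fun g : GG => wd (rankP 14) (IsMatching 14) c (l.map (emap g.1)))]
  apply Finset.sum_congr rfl
  intro g _
  rw [List.map_map]
  congr 2
  funext p
  exact (emap_mul _ _ _).symm

theorem bdry_sym (c : ℕ) {l : List Ed14} (hl : IsMatching 14 l.toFinset) (hc : l.length = c + 1) :
    bdry ℤ (rankP 14) (IsMatching 14) c (sym (c + 1) l) = psum (fun _ => sym c) l := by
  unfold sym
  rw [map_sum, psum_sum]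
  apply Finset.sum_congr rfl
  intro g _
  rw [bdry_wd _ (rankP_inj 14) _ _ (emap_matching g.1 hl) (by rw [List.length_map, hc]), psum_map]

theorem nb_emap {g : Equiv.Perm (Fin 14)} (hg : g ∈ GG) (p q : Ed14) :
    nb (emap g p) (emap g q) = nb p q := by
  have h : ∀ x y, blk (g x) = blk (g y) ↔ blk x = blk y := by
    intro x y
    simp only [blk, Fin.mk.injEq]
    exact (hg.1 x y).symm
  unfold nb emap
  rw [decide_eq_decide]
  rcases le_total (g p.1) (g p.2) with h1 | h1 <;> rcases le_total (g q.1) (g q.2) with h2 | h2 <;>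
    simp only [min_eq_left, min_eq_right, max_eq_left, max_eq_right, h1, h2, h] <;> tauto

theorem lp_emap {g : Equiv.Perm (Fin 14)} (hg : g ∈ GG) (p : Ed14) :
    lp (emap g p) = lp p := by
  have h : ∀ x y, blk (g x) = blk (g y) ↔ blk x = blk y := by
    intro x y
    simp only [blk, Fin.mk.injEq]
    exact (hg.1 x y).symm
  unfold lp emap
  rw [decide_eq_decide]
  rcases le_total (g p.1) (g p.2) with h1 | h1 <;>
    simp only [min_eq_left, min_eq_right, max_eq_left, max_eq_right, h1, h]
  exact eq_comm

theorem F5_emap {g : Equiv.Perm (Fin 14)} (hg : g ∈ GG) (l : List Ed14) :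
    F5 (l.map (emap g)) = F5 l := by
  unfold F5
  rw [alt_map]
  simp only [indic_map, nb_emap hg, lp_emap hg]

theorem fco_sym {l : List Ed14} (hl : IsMatching 14 l.toFinset) (hn : l.Nodup)
    (h5 : l.length = 5) : fco (sym 5 l) = (Fintype.card GG : ZMod 5) * F5 l := by
  unfold sym
  rw [map_sum]
  have : ∀ g : GG, fco (wd (rankP 14) (IsMatching 14) 5 (l.map (emap g.1))) = F5 l := by
    intro g
    rw [← F5_emap g.2]
    exact cochain_wd _ (rankP_inj 14) _ _ F5_alt (emap_matching g.1 hl)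
      (by rw [List.length_map, h5]) (emap_nodup g.1 hl hn)
  simp only [this]
  simp

end FiveTor

namespace FiveTor

open MatchPaper

/-- Generators of the symmetry group. -/
def gen : ℕ → Equiv.Perm (Fin 14)
  | 0 => Equiv.swap 0 1
  | 1 => Equiv.swap 2 3
  | 2 => Equiv.swap 4 5
  | 3 => Equiv.swap 6 7
  | 4 => Equiv.swap 8 9
  | 5 => Equiv.swap 10 11
  | 6 => Equiv.swap 0 2 * Equiv.swap 1 3
  | 7 => Equiv.swap 2 4 * Equiv.swap 3 5
  | 8 => Equiv.swap 6 8 * Equiv.swap 7 9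
  | 9 => Equiv.swap 8 10 * Equiv.swap 9 11
  | 10 => Equiv.swap 0 6 * Equiv.swap 1 7 * Equiv.swap 2 8 * Equiv.swap 3 9 * Equiv.swap 4 10
      * Equiv.swap 5 11
  | _ => 1

theorem gen_mem (n : ℕ) : gen n ∈ GG := by
  match n with
  | 0 => exact mem_GG.2 (by decide +kernel)
  | 1 => exact mem_GG.2 (by decide +kernel)
  | 2 => exact mem_GG.2 (by decide +kernel)
  | 3 => exact mem_GG.2 (by decide +kernel)
  | 4 => exact mem_GG.2 (by decide +kernel)
  | 5 => exact mem_GG.2 (by decide +kernel)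
  | 6 => exact mem_GG.2 (by decide +kernel)
  | 7 => exact mem_GG.2 (by decide +kernel)
  | 8 => exact mem_GG.2 (by decide +kernel)
  | 9 => exact mem_GG.2 (by decide +kernel)
  | 10 => exact mem_GG.2 (by decide +kernel)
  | n + 11 => exact GG.one_mem

/-- Apply a sequence of generators to a word. -/
def act (cs : List ℕ) (l : List Ed14) : List Ed14 :=
  cs.foldl (fun m i => m.map (emap (gen i))) l

theorem sym_act (c : ℕ) (cs : List ℕ) (l : List Ed14) : sym c (act cs l) = sym c l := by
  induction cs generalizing l with
  | nil => rfl
  | cons i cs ih =>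
    have : act (i :: cs) l = act cs (l.map (emap (gen i))) := rfl
    rw [this, ih, sym_inv c l (gen_mem i)]

/-- Sort a word. -/
def srt (l : List Ed14) : List Ed14 := l.insertionSort (fun a b => rankP 14 a ≤ rankP 14 b)

theorem sym_srt (c : ℕ) (l : List Ed14) : sym c l = sg (rankP 14) l • sym c (srt l) := by
  have hp : (srt l).Perm l := List.perm_insertionSort _ l
  by_cases hn : l.Nodup
  · have hs : sg (rankP 14) (srt l) = 1 := by
      apply sg_sorted
      have h1 := List.pairwise_insertionSort (fun a b => rankP 14 a ≤ rankP 14 b) l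
      have h2 : (srt l).Nodup := hp.nodup_iff.2 hn
      exact (h1.and h2).imp (fun {a b} h => lt_of_le_of_ne h.1 (fun e => h.2 (rankP_inj 14 e)))
    have hk : Alt (fun m => sym c m - sg (rankP 14) m • sym c (srt l)) := by
      intro p a b q
      show _ - _ = - (_ - _)
      rw [sym_alt c p a b q, sg_alt (rankP 14) p a b q, neg_smul]
      abel
    have h0 := hk.zero_of_perm hp.symm (by rw [hs, one_smul, sub_self])
    exact sub_eq_zero.1 h0
  · rw [(sym_alt c).zero_of_not_nodup (chain_tf _ c) hn,
      (sg_alt (rankP 14)).zero_of_not_nodup (fun m h => by omega) hn, zero_smul]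

/-- A combination of symmetrised simplices. -/
noncomputable def ev (c : ℕ) (T : List (ℤ × List Ed14)) : SChain ℤ (IsMatching 14) c :=
  (T.map (fun t => t.1 • sym c t.2)).sum

theorem ev_nil (c : ℕ) : ev c [] = 0 := rfl

theorem ev_cons (c : ℕ) (t : ℤ × List Ed14) (T : List (ℤ × List Ed14)) :
    ev c (t :: T) = t.1 • sym c t.2 + ev c T := by
  simp [ev]

theorem ev_append (c : ℕ) (T T' : List (ℤ × List Ed14)) :
    ev c (T ++ T') = ev c T + ev c T' := by
  simp [ev]

/-- Multiply a combination by an integer. -/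
def scale (k : ℤ) (T : List (ℤ × List Ed14)) : List (ℤ × List Ed14) :=
  T.map (fun t => (k * t.1, t.2))

theorem ev_scale (c : ℕ) (k : ℤ) (T : List (ℤ × List Ed14)) :
    ev c (scale k T) = k • ev c T := by
  induction T with
  | nil => simp [scale, ev]
  | cons t T ih =>
    have : scale k (t :: T) = (k * t.1, t.2) :: scale k T := rfl
    rw [this, ev_cons, ev_cons, ih, smul_add, mul_smul]

/-- All deletions of a letter, with signs. -/
def dels : List Ed14 → List (ℤ × List Ed14)
  | [] => []
  | a :: l => (1, l) :: (dels l).map (fun t => (-t.1, a :: t.2))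

theorem psum_dels_aux {c : ℕ} (g : List Ed14 → SChain ℤ (IsMatching 14) c) (l : List Ed14) :
    psum (fun _ => g) l = ((dels l).map (fun t => t.1 • g t.2)).sum := by
  induction l generalizing g with
  | nil => rfl
  | cons a l ih =>
    rw [psum, dels, List.map_cons, List.sum_cons, List.map_map, one_smul,
      ih (fun r => g (a :: r)), sub_eq_add_neg]
    congr 1
    induction dels l with
    | nil => simp
    | cons t T ih' => simp [← ih', add_comm]

/-- The boundary of a combination. -/
def bd (T : List (ℤ × List Ed14)) : List (ℤ × List Ed14) :=
  T.flatMap (fun t => scale t.1 (dels t.2))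

theorem bdry_ev (c : ℕ) (T : List (ℤ × List Ed14))
    (hT : ∀ t ∈ T, IsMatching 14 t.2.toFinset ∧ t.2.length = c + 1) :
    bdry ℤ (rankP 14) (IsMatching 14) c (ev (c + 1) T) = ev c (bd T) := by
  induction T with
  | nil => simp [bd, ev]
  | cons t T ih =>
    have hb : bd (t :: T) = scale t.1 (dels t.2) ++ bd T := rfl
    obtain ⟨h1, h2⟩ := hT t (by simp)
    rw [ev_cons, map_add, map_smul, bdry_sym c h1 h2, hb, ev_append, ev_scale,
      ih (fun t ht => hT t (by simp [ht])), psum_dels_aux]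
    rfl

/-- Rewrite a term. -/
def term (k : ℤ) (l : List Ed14) : ℤ × List Ed14 := (k * sg (rankP 14) l, srt l)

theorem ev_term (c : ℕ) (k : ℤ) (l : List Ed14) (cs : List ℕ) :
    (term k (act cs l)).1 • sym c (term k (act cs l)).2 = k • sym c l := by
  rw [term, mul_smul, ← sym_srt, sym_act]

/-- Rewrite twice a combination using symmetries. -/
def rew : List (ℤ × List Ed14) → List (List ℕ × List ℕ) → List (ℤ × List Ed14)
  | t :: T, p :: C => term t.1 (act p.1 t.2) :: term t.1 (act p.2 t.2) :: rew T C
  | t :: T, [] => (2 * t.1, t.2) :: rew T []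
  | [], _ => []

theorem ev_rew (c : ℕ) (T : List (ℤ × List Ed14)) (C : List (List ℕ × List ℕ)) :
    ev c (rew T C) = (2 : ℤ) • ev c T := by
  induction T generalizing C with
  | nil => simp [rew, ev]
  | cons t T ih =>
    cases C with
    | nil =>
      rw [rew, ev_cons, ev_cons, ih, smul_add, mul_smul]
    | cons p C =>
      rw [rew, ev_cons, ev_cons, ev_cons, ev_term, ev_term, ih, smul_add, two_smul ℤ (t.1 • _)]
      abel

/-- Add a term to a combination, collecting coefficients. -/
def insT (k : ℤ) (l : List Ed14) : List (ℤ × List Ed14) → List (ℤ × List Ed14)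
  | [] => [(k, l)]
  | t :: T => if t.2 = l then (k + t.1, l) :: T else t :: insT k l T

theorem ev_insT (c : ℕ) (k : ℤ) (l : List Ed14) (T : List (ℤ × List Ed14)) :
    ev c (insT k l T) = k • sym c l + ev c T := by
  induction T with
  | nil => rw [insT, ev_cons]
  | cons t T ih =>
    rw [insT]
    split_ifs with h
    · rw [ev_cons, ev_cons, h, add_smul]
      abel
    · rw [ev_cons, ev_cons, ih]
      abel

/-- Collect coefficients. -/
def gath : List (ℤ × List Ed14) → List (ℤ × List Ed14)
  | [] => []
  | t :: T => insT t.1 t.2 (gath T)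

theorem ev_gath (c : ℕ) (T : List (ℤ × List Ed14)) : ev c (gath T) = ev c T := by
  induction T with
  | nil => rfl
  | cons t T ih => rw [gath, ev_insT, ih, ev_cons]

theorem ev_zero_of (c : ℕ) (T : List (ℤ × List Ed14))
    (h : (gath T).all (fun t => t.1 == 0) = true) : ev c T = 0 := by
  rw [← ev_gath]
  generalize gath T = T at h
  induction T with
  | nil => rfl
  | cons t T ih =>
    rw [List.all_cons, Bool.and_eq_true] at h
    rw [ev_cons, ih h.2, beq_iff_eq.1 h.1]
    simp

/-- The filling chain, as a combination of words. -/
def wList : List (ℤ × List Ed14) := [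
  (2, [(0, 2), (1, 6), (3, 8), (4, 7), (5, 9), (10, 13)]),
  (-2, [(0, 2), (1, 6), (3, 8), (4, 7), (5, 9), (12, 13)]),
  (-4, [(0, 2), (1, 6), (3, 8), (4, 7), (5, 10), (11, 13)]),
  (4, [(0, 2), (1, 6), (3, 8), (4, 7), (5, 10), (12, 13)]),
  (4, [(0, 2), (1, 6), (3, 12), (4, 7), (5, 8), (9, 13)]),
  (-4, [(0, 2), (1, 6), (3, 12), (4, 7), (5, 8), (10, 13)]),
  (4, [(0, 2), (1, 6), (3, 12), (4, 8), (5, 10), (9, 13)]),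
  (1, [(0, 6), (1, 8), (2, 7), (3, 9), (4, 10), (5, 13)]),
  (-3, [(0, 6), (1, 8), (2, 7), (3, 9), (4, 12), (5, 13)]),
  (-2, [(0, 6), (1, 8), (2, 7), (3, 9), (4, 12), (10, 13)]),
  (-4, [(0, 6), (1, 8), (2, 7), (3, 10), (4, 9), (5, 13)]),
  (-1, [(0, 6), (1, 8), (2, 7), (3, 10), (4, 9), (12, 13)]),
  (6, [(0, 6), (1, 8), (2, 7), (3, 10), (4, 12), (5, 13)]),
  (4, [(0, 6), (1, 8), (2, 7), (3, 10), (4, 12), (9, 13)])]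

/-- The cycle, as a combination of words. -/
def zList : List (ℤ × List Ed14) := [
  (1, [(0, 6), (1, 8), (2, 7), (3, 9), (4, 12)]),
  (1, [(0, 6), (1, 8), (2, 7), (3, 10), (4, 9)]),
  (-2, [(0, 6), (1, 8), (2, 7), (3, 10), (4, 12)])]

/-- Symmetries used to compare the terms of the boundary of the filling chain. -/
def wCert : List (List ℕ × List ℕ) := [
  ([], []), ([], []), ([2, 6, 8], [2, 6, 8]), ([], []), ([2, 6, 8], [2, 6, 8]), ([], []),
  ([], []), ([], []), ([2, 6, 8], [2, 6, 8]), ([], []), ([2, 6, 8], [2, 6, 8]), ([], []),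
  ([], []), ([], []), ([], []), ([], [6, 8]), ([2, 5, 6, 8], [2, 5, 6, 8]), ([], []),
  ([], [0, 1, 2, 3, 4, 5, 6, 7, 6, 8, 9, 8, 10]), ([], [2, 3, 5, 8, 9, 8]),
  ([2, 5, 6, 9, 8], [2, 5, 6, 9, 8]), ([], [6, 8]), ([2, 6, 8], [2, 6, 8]), ([], []),
  ([], []), ([], []), ([9], [9]), ([], []), ([], []), ([], []), ([], []), ([], [2, 3, 4, 8]),
  ([2, 4, 6, 8], [2, 4, 6, 8]), ([], []), ([5, 9], [5, 9]), ([], []), ([], []),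
  ([2, 5, 8, 9, 8], [2, 5, 8, 9, 8]), ([2, 5, 6, 9, 8], [2, 5, 6, 9, 8]), ([4, 9], [4, 9]),
  ([2], [2]), ([], [2, 9]), ([], []), ([0, 1, 8], [0, 1, 8]), ([3, 4, 6], [3, 4, 6]),
  ([0, 1, 3, 4, 6, 8], [0, 1, 3, 4, 6, 8]), ([], []), ([], [10]), ([], []),
  ([0, 1, 8], [0, 1, 8]), ([3, 4, 6], [3, 4, 6]), ([0, 1, 3, 4, 6, 8], [0, 1, 3, 4, 6, 8]),
  ([], []), ([], []), ([1, 2, 3, 7, 8], [1, 2, 3, 7, 8]), ([0, 2, 4, 7], [0, 2, 4, 7]),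
  ([0, 2, 4, 6, 7, 8], [0, 2, 4, 6, 7, 8]), ([1, 2, 3, 6, 7], [1, 2, 3, 6, 7]),
  ([5, 10], [5, 10]), ([], []), ([], [1, 3, 5, 8, 9, 8]),
  ([0, 1, 4, 5, 9, 8], [0, 1, 4, 5, 9, 8]), ([1, 3, 5, 9, 10], [1, 3, 5, 9, 10]), ([], []),
  ([0, 1, 2, 4, 5, 8, 9, 10], [0, 1, 2, 4, 5, 8, 9, 10]), ([], []), ([], [0, 2, 4, 6, 7, 6]),
  ([], [1, 2, 3, 4, 6, 7, 9, 8, 10]), ([], [0, 1, 4, 5, 7, 6, 8, 9, 10]),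
  ([1, 2, 3, 4, 6, 7], [1, 2, 3, 4, 6, 7]), ([0, 1, 4, 5, 8, 9, 10], [0, 1, 4, 5, 8, 9, 10]),
  ([], []), ([], [1, 3, 5, 8, 9, 8]), ([0, 1, 5, 9, 8], [0, 1, 5, 9, 8]), ([], [0, 8]),
  ([0, 1, 3, 4, 6, 8], [0, 1, 3, 4, 6, 8]),
  ([0, 1, 2, 4, 5, 8, 9, 10], [0, 1, 2, 4, 5, 8, 9, 10]), ([], []), ([], [1, 3, 5, 8, 9, 8]),
  ([0, 2, 4, 7, 9], [0, 2, 4, 7, 9]), ([0, 2, 6, 7, 8, 9, 8], [0, 2, 6, 7, 8, 9, 8]),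
  ([1, 2, 3, 6, 7], [1, 2, 3, 6, 7]), ([3, 6, 9, 10], [3, 6, 9, 10]), ([], [])]

/-- Symmetries used to compare the terms of the boundary of the cycle. -/
def zCert : List (List ℕ × List ℕ) := [
  ([], []), ([0, 1, 8], [0, 1, 8]), ([3, 4, 6], [3, 4, 6]),
  ([0, 1, 3, 4, 6, 8], [0, 1, 3, 4, 6, 8]), ([], [10]), ([], [0, 2, 4, 6, 7, 6]),
  ([], [1, 2, 3, 4, 6, 7, 9, 8, 10]), ([], [0, 1, 4, 5, 7, 6, 8, 9, 10]), ([], []),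
  ([10], [10]), ([], [1, 3, 5, 8, 9, 8]), ([0, 1, 5, 9, 8], [0, 1, 5, 9, 8]), ([], [0, 8]),
  ([0, 1, 3, 4, 6, 8], [0, 1, 3, 4, 6, 8]), ([10], [10])]

theorem check_w : (gath (rew (bd wList) wCert ++ scale (-10) zList)).all (fun t => t.1 == 0) =
    true := by
  decide +kernel

theorem check_z : (gath (rew (bd zList) zCert)).all (fun t => t.1 == 0) = true := by
  decide +kernel

/-- A computable test for matchings. -/
def mok (l : List Ed14) : Bool :=
  l.all (fun p => decide (p.1 < p.2)) && l.all (fun p => l.all (fun q => decide (p = q) ||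
    decide (p.1 ≠ q.1 ∧ p.1 ≠ q.2 ∧ p.2 ≠ q.1 ∧ p.2 ≠ q.2)))

theorem matching_of_mok {l : List Ed14} (h : mok l = true) : IsMatching 14 l.toFinset := by
  simp only [mok, Bool.and_eq_true, List.all_eq_true, Bool.or_eq_true, decide_eq_true_eq] at h
  constructor
  · intro p hp
    exact h.1 p (List.mem_toFinset.1 hp)
  · intro p hp q hq hpq
    exact (h.2 p (List.mem_toFinset.1 hp) q (List.mem_toFinset.1 hq)).resolve_left hpq

theorem wList_ok : ∀ t ∈ wList, IsMatching 14 t.2.toFinset ∧ t.2.length = 5 + 1 := by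
  have h : wList.all (fun t => mok t.2 && t.2.length == 6) = true := by
    decide +kernel
  intro t ht
  have h1 := List.all_eq_true.1 h t ht
  simp only [Bool.and_eq_true, beq_iff_eq] at h1
  exact ⟨matching_of_mok h1.1, h1.2⟩

theorem zList_ok : ∀ t ∈ zList, IsMatching 14 t.2.toFinset ∧ t.2.length = 4 + 1 ∧ t.2.Nodup ∧
    ∀ p ∈ t.2, p.1 ≠ 13 ∧ p.2 ≠ 13 := by
  have h : zList.all (fun t => mok t.2 && t.2.length == 5 && decide t.2.Nodup &&
      t.2.all (fun p => decide (p.1 ≠ 13 ∧ p.2 ≠ 13))) = true := by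
    decide +kernel
  intro t ht
  have h1 := List.all_eq_true.1 h t ht
  simp only [Bool.and_eq_true, beq_iff_eq, List.all_eq_true, decide_eq_true_eq] at h1
  exact ⟨matching_of_mok h1.1.1.1, h1.1.1.2, h1.1.2, h1.2⟩

/-- The cycle. -/
noncomputable def zch : SChain ℤ (IsMatching 14) 5 := ev 5 zList

theorem zch_cycle : bdry ℤ (rankP 14) (IsMatching 14) 4 zch = 0 := by
  rw [zch, bdry_ev 4 zList (fun t ht => ⟨(zList_ok t ht).1, (zList_ok t ht).2.1⟩)]
  have h := ev_zero_of 4 _ check_z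
  rw [ev_rew, two_smul] at h
  exact chain_tf _ _ _ (eq_neg_of_add_eq_zero_left h)

theorem five_zch : (5 : ℤ) • zch = bdry ℤ (rankP 14) (IsMatching 14) 5 (ev 6 wList) := by
  rw [bdry_ev 5 wList wList_ok, zch]
  have h := ev_zero_of 5 _ check_w
  rw [ev_append, ev_rew, ev_scale] at h
  have h2 : (2 : ℤ) • (ev 5 (bd wList) - (5 : ℤ) • ev 5 zList) = 0 := by
    rw [← h, smul_sub, smul_smul]
    norm_num [sub_eq_add_neg]
  rw [two_smul] at h2
  have h3 := chain_tf _ _ _ (eq_neg_of_add_eq_zero_left h2)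
  exact (sub_eq_zero.1 h3).symm

theorem F5_zList : (zList.map (fun t => (t.1 : ZMod 5) * F5 t.2)).sum ≠ 0 := by
  decide +kernel

theorem fco_zch : fco zch ≠ 0 := by
  have h : ∀ T : List (ℤ × List Ed14), (∀ t ∈ T, IsMatching 14 t.2.toFinset ∧ t.2.length = 5 ∧
      t.2.Nodup) → fco (ev 5 T) =
      (Fintype.card GG : ZMod 5) * (T.map (fun t => (t.1 : ZMod 5) * F5 t.2)).sum := by
    intro T hT
    induction T with
    | nil => simp [ev]
    | cons t T ih =>
      obtain ⟨h1, h2, h3⟩ := hT t (by simp)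
      rw [ev_cons, map_add, map_smul, fco_sym h1 h3 h2, ih (fun t ht => hT t (by simp [ht])),
        List.map_cons, List.sum_cons, zsmul_eq_mul]
      ring
  rw [zch, h zList (fun t ht => ⟨(zList_ok t ht).1, (zList_ok t ht).2.1, (zList_ok t ht).2.2.1⟩)]
  have : Fact (Nat.Prime 5) := ⟨by norm_num⟩
  apply mul_ne_zero _ F5_zList
  rw [Ne, ZMod.natCast_eq_zero_iff]
  exact card_GG

end FiveTor

namespace FiveTor

open MatchPaper

/-- The inclusion on edges. -/
def iot (h : 13 ≤ 14) : Fin 13 × Fin 13 → Ed14 := fun p => (Fin.castLE h p.1, Fin.castLE h p.2)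

theorem iot_inj (h : 13 ≤ 14) : Function.Injective (iot h) := by
  rintro ⟨a, b⟩ ⟨c, d⟩ e
  simp only [iot, Prod.mk.injEq, Fin.castLE_inj] at e
  rw [e.1, e.2]

theorem iot_rank (h : 13 ≤ 14) (p q : Fin 13 × Fin 13) :
    rankP 14 (iot h p) < rankP 14 (iot h q) ↔ rankP 13 p < rankP 13 q := by
  have h1 := p.1.2
  have h2 := p.2.2
  have h3 := q.1.2
  have h4 := q.2.2
  simp only [rankP, iot, Fin.val_castLE]
  omega

theorem iot_matching (h : 13 ≤ 14) (σ : Finset (Fin 13 × Fin 13)) :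
    IsMatching 14 (σ.image (iot h)) ↔ IsMatching 13 σ := by
  simp only [IsMatching, Finset.forall_mem_image, (iot_inj h).ne_iff]
  simp [iot, Fin.castLE_inj]

theorem incl_basis (h : 13 ≤ 14) (c : ℕ) (τ : Finset (Fin 13 × Fin 13)) :
    inclChain ℤ 13 14 h c (basisOrZero ℤ (IsMatching 13) c τ) =
      basisOrZero ℤ (IsMatching 14) c (τ.image (iot h)) := by
  have hcard : (τ.image (iot h)).card = τ.card := Finset.card_image_of_injective _ (iot_inj h)
  by_cases hτ : IsMatching 13 τ ∧ τ.card = c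
  · have hs : mapSign (rankP 13) (rankP 14) (iot h) τ = 1 := by
      unfold mapSign
      rw [Finset.filter_false_of_mem]
      · rfl
      · rintro ⟨p, q⟩ -
        rw [iot_rank]
        simp only
        omega
    have e : basisOrZero ℤ (IsMatching 13) c τ = Finsupp.single ⟨τ, hτ⟩ 1 := dif_pos hτ
    rw [e, inclChain, chainMap, Finsupp.lsum_single, LinearMap.toSpanSingleton_apply, one_smul]
    show mapSign (rankP 13) (rankP 14) (iot h) τ • _ = _
    rw [hs, one_smul]
    rfl
  · have e : basisOrZero ℤ (IsMatching 13) c τ = 0 := dif_neg hτ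
    have e' : basisOrZero ℤ (IsMatching 14) c (τ.image (iot h)) = 0 := by
      apply dif_neg
      rwa [hcard, iot_matching]
    rw [e, e', map_zero]

theorem incl_wd (h : 13 ≤ 14) (c : ℕ) (l : List (Fin 13 × Fin 13)) :
    inclChain ℤ 13 14 h c (wd (rankP 13) (IsMatching 13) c l) =
      wd (rankP 14) (IsMatching 14) c (l.map (iot h)) := by
  rw [wd, wd, map_smul, incl_basis, sg_map (rankP 13) (rankP 14) (iot h) (iot_rank h)]
  congr 2
  ext x
  simp

theorem single_eq {m : ℕ} (c : ℕ) (σ : {σ : Finset (Fin m × Fin m) // IsMatching m σ ∧ σ.card = c})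
    (b : ℤ) : Finsupp.single σ b = b • basisOrZero ℤ (IsMatching m) c σ.1 := by
  rw [basisOrZero, dif_pos σ.2]
  simp

theorem incl_bdry (h : 13 ≤ 14) (c : ℕ) (x : SChain ℤ (IsMatching 13) (c + 1)) :
    inclChain ℤ 13 14 h c (bdry ℤ (rankP 13) (IsMatching 13) c x) =
      bdry ℤ (rankP 14) (IsMatching 14) c (inclChain ℤ 13 14 h (c + 1) x) := by
  suffices H : (inclChain ℤ 13 14 h c).comp (bdry ℤ (rankP 13) (IsMatching 13) c) =
      (bdry ℤ (rankP 14) (IsMatching 14) c).comp (inclChain ℤ 13 14 h (c + 1)) by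
    exact DFunLike.congr_fun H x
  apply Finsupp.lhom_ext
  intro σ b
  have hσ : IsMatching 14 (σ.1.image (iot h)) ∧ (σ.1.image (iot h)).card = c + 1 := by
    rw [iot_matching, Finset.card_image_of_injective _ (iot_inj h)]
    exact σ.2
  rw [single_eq, map_smul, map_smul, LinearMap.comp_apply, LinearMap.comp_apply, incl_basis,
    bdry_basis _ _ _ hσ, bdry_basis _ _ _ σ.2, map_sum, Finset.sum_image (iot_inj h).injOn]
  congr 1
  apply Finset.sum_congr rfl
  intro v _
  rw [map_smul, incl_basis, Finset.image_erase (iot_inj h), Finset.filter_image,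
    Finset.card_image_of_injective _ (iot_inj h)]
  simp only [iot_rank]

theorem incl_inj (h : 13 ≤ 14) (c : ℕ) : Function.Injective (inclChain ℤ 13 14 h c) := by
  let φ : {σ : Finset (Fin 13 × Fin 13) // IsMatching 13 σ ∧ σ.card = c} →
      {σ : Finset Ed14 // IsMatching 14 σ ∧ σ.card = c} := fun σ => ⟨σ.1.image (iot h), by
    rw [iot_matching, Finset.card_image_of_injective _ (iot_inj h)]
    exact σ.2⟩
  have hφ : Function.Injective φ := by
    intro σ τ e
    simp only [φ, Subtype.mk.injEq] at e
    exact Subtype.ext (Finset.image_injective (iot_inj h) e)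
  have H : inclChain ℤ 13 14 h c = Finsupp.lmapDomain ℤ ℤ φ := by
    apply Finsupp.lhom_ext
    intro σ b
    rw [Finsupp.lmapDomain_apply, Finsupp.mapDomain_single, single_eq, single_eq, map_smul,
      incl_basis]
  rw [H]
  exact Finsupp.mapDomain_injective hφ

theorem exists_lift (h : 13 ≤ 14) (l : List Ed14) (hl : ∀ p ∈ l, p.1 ≠ 13 ∧ p.2 ≠ 13) :
    ∃ l' : List (Fin 13 × Fin 13), l'.map (iot h) = l := by
  induction l with
  | nil => exact ⟨[], rfl⟩
  | cons p l ih =>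
    obtain ⟨l', hl'⟩ := ih (fun q hq => hl q (by simp [hq]))
    obtain ⟨h1, h2⟩ := hl p (by simp)
    refine ⟨(⟨p.1.val, ?_⟩, ⟨p.2.val, ?_⟩) :: l', ?_⟩
    · have := p.1.2
      have : p.1.val ≠ 13 := fun e => h1 (Fin.ext e)
      omega
    · have := p.2.2
      have : p.2.val ≠ 13 := fun e => h2 (Fin.ext e)
      omega
    · rw [List.map_cons, hl']
      rfl

theorem sym_mem_range (h : 13 ≤ 14) (c : ℕ) (l : List Ed14)
    (hl : ∀ p ∈ l, p.1 ≠ 13 ∧ p.2 ≠ 13) :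
    sym c l ∈ LinearMap.range (inclChain ℤ 13 14 h c) := by
  unfold sym
  apply Submodule.sum_mem
  intro g _
  obtain ⟨l', hl'⟩ := exists_lift h (l.map (emap g.1)) (by
    intro p hp
    obtain ⟨q, hq, rfl⟩ := List.mem_map.1 hp
    obtain ⟨h1, h2⟩ := hl q hq
    have hg : g.1 13 = 13 := (mem_GG.1 g.2).2.2
    have k1 : g.1 q.1 ≠ 13 := fun e => h1 (g.1.injective (e.trans hg.symm))
    have k2 : g.1 q.2 ≠ 13 := fun e => h2 (g.1.injective (e.trans hg.symm))
    unfold emap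
    rcases le_total (g.1 q.1) (g.1 q.2) with hle | hle
    · simp only [min_eq_left hle, max_eq_right hle]
      exact ⟨k1, k2⟩
    · simp only [min_eq_right hle, max_eq_left hle]
      exact ⟨k2, k1⟩)
  rw [← hl', ← incl_wd]
  exact LinearMap.mem_range_self _ _

theorem zch_mem_range (h : 13 ≤ 14) : zch ∈ LinearMap.range (inclChain ℤ 13 14 h 5) := by
  have H : ∀ T : List (ℤ × List Ed14), (∀ t ∈ T, ∀ p ∈ t.2, p.1 ≠ 13 ∧ p.2 ≠ 13) →
      ev 5 T ∈ LinearMap.range (inclChain ℤ 13 14 h 5) := by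
    intro T hT
    induction T with
    | nil => exact Submodule.zero_mem _
    | cons t T ih =>
      rw [ev_cons]
      exact Submodule.add_mem _ (Submodule.smul_mem _ _ (sym_mem_range h 5 _ (hT t (by simp))))
        (ih (fun t ht => hT t (by simp [ht])))
  exact H zList (fun t ht => (zList_ok t ht).2.2.2)

theorem inclStar_mk (h : 13 ≤ 14) (x : cycLow ℤ (rankP 13) (IsMatching 13) 5)
    (y : cycLow ℤ (rankP 14) (IsMatching 14) 5) (hxy : inclChain ℤ 13 14 h 5 x.1 = y.1) :
    inclStar ℤ 13 14 h 4 (Submodule.Quotient.mk x) = Submodule.Quotient.mk y := by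
  have hr : ∀ u ∈ cycLow ℤ (rankP 13) (IsMatching 13) 5,
      inclChain ℤ 13 14 h 5 u ∈ cycLow ℤ (rankP 14) (IsMatching 14) 5 := by
    intro u hu
    have hu' : bdry ℤ (rankP 13) (IsMatching 13) 4 u = 0 := hu
    show bdry ℤ (rankP 14) (IsMatching 14) 4 _ = 0
    rw [← incl_bdry, hu', map_zero]
  have er : restrictL ℤ (inclChain ℤ 13 14 h 5) (cycLow ℤ (rankP 13) (IsMatching 13) 5)
      (cycLow ℤ (rankP 14) (IsMatching 14) 5) = (inclChain ℤ 13 14 h 5).restrict hr := dif_pos hr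
  unfold inclStar subQuotMapL
  rw [er, descendL, dif_pos, Submodule.mapQ_apply]
  · congr 1
    exact Subtype.ext hxy
  · rintro u ⟨v, hv⟩
    refine ⟨inclChain ℤ 13 14 h 6 v, ?_⟩
    rw [← incl_bdry, hv]
    rfl

end FiveTor

open MatchPaper in
/-- There is an element `δ` of `H̃₄(M₁₃; ℤ)` whose image in `H̃₄(M₁₄; ℤ)`
under the inclusion-induced map has order a nonzero multiple of `5`; consequently the order of
`δ` is infinite or a nonzero multiple of `5`. -/
theorem element_of_M13_with_five_torsion_image :
    ∃ δ : MH ℤ 13 4,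
      (addOrderOf (inclStar ℤ 13 14 (by omega) 4 δ) ≠ 0 ∧
        5 ∣ addOrderOf (inclStar ℤ 13 14 (by omega) 4 δ)) ∧
      (¬ IsOfFinAddOrder δ ∨ (addOrderOf δ ≠ 0 ∧ 5 ∣ addOrderOf δ)) := by
  obtain ⟨z, hz⟩ := FiveTor.zch_mem_range (by omega)
  have hzc : z ∈ cycLow ℤ (rankP 13) (IsMatching 13) 5 := by
    show bdry ℤ (rankP 13) (IsMatching 13) 4 z = 0
    apply FiveTor.incl_inj (by omega) 4
    rw [FiveTor.incl_bdry, hz, FiveTor.zch_cycle, map_zero]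
  have key := FiveTor.inclStar_mk (by omega) ⟨z, hzc⟩ ⟨FiveTor.zch, FiveTor.zch_cycle⟩ hz
  have h1 : 5 ∣ addOrderOf (inclStar ℤ 13 14 (by omega) 4
      (Submodule.Quotient.mk ⟨z, hzc⟩ : MH ℤ 13 4)) := by
    rw [key]
    suffices hQ : ∀ n : ℕ, n • (Submodule.Quotient.mk
        (⟨FiveTor.zch, FiveTor.zch_cycle⟩ : cycLow ℤ (rankP 14) (IsMatching 14) 5) : MH ℤ 14 4) = 0 →
        5 ∣ n by
      exact hQ _ (addOrderOf_nsmul_eq_zero _)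
    intro n ho
    rw [← Submodule.Quotient.mk_smul, Submodule.Quotient.mk_eq_zero] at ho
    obtain ⟨v, hv⟩ := ho
    have hv' : bdry ℤ (rankP 14) (IsMatching 14) 5 v = n • FiveTor.zch := hv
    have hf := congrArg FiveTor.fco hv'
    rw [FiveTor.fco_bdry, map_nsmul, nsmul_eq_mul] at hf
    have : Fact (Nat.Prime 5) := ⟨by norm_num⟩
    rcases mul_eq_zero.1 hf.symm with h | h
    · exact (ZMod.natCast_eq_zero_iff n 5).1 h
    · exact absurd h FiveTor.fco_zch
  have h5 : (5 : ℕ) • inclStar ℤ 13 14 (by omega) 4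
      (Submodule.Quotient.mk ⟨z, hzc⟩ : MH ℤ 13 4) = 0 := by
    rw [key, ← Submodule.Quotient.mk_smul, Submodule.Quotient.mk_eq_zero]
    refine ⟨FiveTor.ev 6 FiveTor.wList, ?_⟩
    rw [← FiveTor.five_zch]
    show (5 : ℤ) • FiveTor.zch = (5 : ℕ) • FiveTor.zch
    rw [← natCast_zsmul]
    rfl
  refine ⟨Submodule.Quotient.mk ⟨z, hzc⟩, ⟨?_, h1⟩, ?_⟩
  · intro h0
    have := addOrderOf_dvd_of_nsmul_eq_zero h5
    rw [h0] at this
    omega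
  · by_cases hfin : IsOfFinAddOrder (Submodule.Quotient.mk ⟨z, hzc⟩ : MH ℤ 13 4)
    · right
      refine ⟨hfin.addOrderOf_pos.ne', h1.trans ?_⟩
      exact addOrderOf_map_dvd (inclStar ℤ 13 14 (by omega) 4).toAddMonoidHom _
    · exact Or.inl hfin
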